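/- arXiv:1312.4337 — 6 statements merged into one kernel-verified Lean document; each statement's English description precedes it below -/
import Mathlib

section
/- For every t ∈ (0,T], every multi-index β ∈ ℕⁿ and all x, ξ ∈ ℝⁿ, the derivative ∂_ξ^β u(x,ξ,t) satisfies |∂_ξ^β u(x,ξ,t)| ≤ t^{|β|/2} Π_{j=1}^n A_{β_j}, where A_k = 2^{k/2} Γ((k+1)/2)/√π. -/
open MeasureTheory ProbabilityTheory

/-- `expNeg L = e^{-L}` for `L ∈ [0,∞]`, with the convention `e^{-∞} = 0`. -/
noncomputable def expNeg (L : ENNReal) : ℝ := if L = ⊤ then 0 else Real.exp (-L.toReal)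

/-- Partial derivative in the `j`-th coordinate. -/
noncomputable def pd {ι : Type*} [DecidableEq ι] {E : Type*} [NormedAddCommGroup E]
    [NormedSpace ℝ E] (j : ι) (f : (ι → ℝ) → E) : (ι → ℝ) → E :=
  fun x => deriv (fun s : ℝ => f (Function.update x j s)) (x j)

/-- Iterated partial derivative `∂^β` associated with a multi-index `β`. -/
noncomputable def mderiv {ι : Type*} [Fintype ι] [DecidableEq ι] {E : Type*}
    [NormedAddCommGroup E] [NormedSpace ℝ E] (β : ι → ℕ) (f : (ι → ℝ) → E) : (ι → ℝ) → E :=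
  (Finset.univ : Finset ι).toList.foldr (fun j g => (pd j)^[β j] g) f

/-- `β! = ∏ j (β j)!` for a multi-index `β`. -/
def mfact {ι : Type*} [Fintype ι] (β : ι → ℕ) : ℕ := ∏ j, (β j).factorial

/-- `A k = 2^{k/2} Γ((k+1)/2) / √π`. -/
noncomputable def A (k : ℕ) : ℝ :=
  (2 : ℝ) ^ ((k : ℝ) / 2) * Real.Gamma (((k : ℝ) + 1) / 2) / Real.sqrt Real.pi

/-- `B m = max_{0 ≤ k ≤ m} A k`. -/
noncomputable def B (m : ℕ) : ℝ := ⨆ k : Fin (m + 1), A k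

/-- The hypotheses that `W` is an `n`-dimensional Brownian motion on `[0,T]`. -/
structure IsBrownian (n : ℕ) (T : ℝ) {Ω : Type*} [MeasurableSpace Ω]
    (P : Measure Ω) (W : ℝ → Ω → Fin n → ℝ) : Prop where
  meas : ∀ s : ℝ, Measurable (W s)
  start : ∀ᵐ ω ∂P, W 0 ω = 0
  cont : ∀ᵐ ω ∂P, ContinuousOn (fun s => W s ω) (Set.Icc 0 T)
  indepIncr : ∀ (m : ℕ) (τ : Fin (m + 1) → ℝ), Monotone τ → (∀ i, τ i ∈ Set.Icc 0 T) →
    iIndepFun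
      (fun i : Fin m => fun ω => W (τ i.succ) ω - W (τ i.castSucc) ω) P
  gaussCoord : ∀ s t : ℝ, 0 ≤ s → s ≤ t → t ≤ T → ∀ j : Fin n,
    P.map (fun ω => W t ω j - W s ω j) = gaussianReal 0 ((t - s).toNNReal)
  coordIndep : ∀ s t : ℝ, 0 ≤ s → s ≤ t → t ≤ T →
    iIndepFun (fun j : Fin n => fun ω => W t ω j - W s ω j) P

/-- The Feynman–Kac integrand `e^{-i W(t)·ξ} e^{-∫₀ᵗ V(x - W(t)/2 + W(s)) ds}`. -/
noncomputable def FK {n : ℕ} {Ω : Type*} (W : ℝ → Ω → Fin n → ℝ) (V : (Fin n → ℝ) → ℝ)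
    (t : ℝ) (x ξ : Fin n → ℝ) (ω : Ω) : ℂ :=
  Complex.exp (-(Complex.I * ((∑ j, W t ω j * ξ j : ℝ) : ℂ))) *
    ((expNeg (∫⁻ s in Set.Ioc (0 : ℝ) t,
        ENNReal.ofReal (V (fun j => x j - W t ω j / 2 + W s ω j))) : ℝ) : ℂ)

/-- The Weyl symbol `u(x, ξ, t)` of `e^{-tH}` given by the Feynman–Kac formula. -/
noncomputable def uSym {n : ℕ} {Ω : Type*} [MeasurableSpace Ω] (P : Measure Ω)
    (W : ℝ → Ω → Fin n → ℝ) (V : (Fin n → ℝ) → ℝ) (t : ℝ) (x ξ : Fin n → ℝ) : ℂ :=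
  ∫ ω, FK W V t x ξ ω ∂P

/-- The finite set of nonzero multi-indices `β` with `β ≤ α` (componentwise). -/
def lowerMulti {ι : Type*} [Fintype ι] [DecidableEq ι] (α : ι → ℕ) : Finset (ι → ℕ) :=
  (Finset.Iic α).erase 0

/-- The Constantine–Savits index set `F(α)`: functions `φ` on the nonzero multi-indices
`β ≤ α` (extended by `0` elsewhere) such that `∑_{0 ≠ β ≤ α} φ(β)·β = α`. -/
def FaaF {ι : Type*} [Fintype ι] [DecidableEq ι] (α : ι → ℕ) : Set ((ι → ℕ) → ℕ) :=
  {φ | (∀ β, β ∉ lowerMulti α → φ β = 0) ∧ ∑ β ∈ lowerMulti α, φ β • β = α}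

/-- `|S(α)|`: the number of sites `j` with `α j ≠ 0`. -/
def suppCard {ι : Type*} [Fintype ι] (α : ι → ℕ) : ℕ :=
  (Finset.univ.filter fun j => α j ≠ 0).card

theorem gauss_abs_moment (v : NNReal) (hv : v ≠ 0) (k : ℕ) :
    ∫ x, |x| ^ k ∂(gaussianReal 0 v) = (v : ℝ) ^ ((k : ℝ) / 2) * A k := by
  have hv' : (0 : ℝ) < v := by positivity
  rw [integral_gaussianReal_eq_integral_smul hv]
  have h1 : ∀ x : ℝ, gaussianPDFReal 0 v x • |x| ^ k =
      (fun y : ℝ => (√(2 * Real.pi * v))⁻¹ *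
        (y ^ (k : ℝ) * Real.exp (-(2 * (v : ℝ))⁻¹ * y ^ (2 : ℝ)))) |x| := by
    intro x
    simp only [gaussianPDFReal, smul_eq_mul, Real.rpow_natCast, sub_zero, Real.rpow_ofNat, sq_abs]
    rw [show -x ^ 2 / (2 * (v : ℝ)) = -(2 * (v : ℝ))⁻¹ * x ^ 2 by field_simp]
    ring
  refine ((integral_congr_ae (Filter.Eventually.of_forall h1)).trans (integral_comp_abs
    (f := fun y : ℝ => (√(2 * Real.pi * v))⁻¹ *
        (y ^ (k : ℝ) * Real.exp (-(2 * (v : ℝ))⁻¹ * y ^ (2 : ℝ)))))).trans ?_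
  rw [integral_const_mul,
    integral_rpow_mul_exp_neg_mul_rpow (by norm_num) (by have : (0:ℝ) ≤ k := k.cast_nonneg
                                                         linarith) (by positivity)]
  rw [Real.inv_rpow (by positivity), ← Real.rpow_neg (by positivity), Real.sqrt_eq_rpow,
    show -(-((k : ℝ) + 1) / 2) = (k : ℝ) / 2 + 1 / 2 by ring, Real.rpow_add (by positivity), A,
    Real.sqrt_eq_rpow, show 2 * Real.pi * (v : ℝ) = (2 * v) * Real.pi by ring,
    Real.mul_rpow (x := 2 * (v : ℝ)) (y := Real.pi) (by positivity) (by positivity),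
    Real.mul_rpow (x := 2) (y := (v : ℝ)) (z := (k : ℝ) / 2) (by positivity) (by positivity)]
  have : (2 * (v : ℝ)) ^ ((1 : ℝ) / 2) ≠ 0 := by positivity
  have : Real.pi ^ ((1 : ℝ) / 2) ≠ 0 := by positivity
  field_simp

theorem gauss_abs_integrable (v : NNReal) (k : ℕ) :
    Integrable (fun x : ℝ => |x| ^ k) (gaussianReal 0 v) := by
  have h := (memLp_id_gaussianReal (μ := 0) (v := v) (k : NNReal)).integrable_norm_pow'
  simpa using h

/-- The `γ`-th moment transform. -/
noncomputable def PhiT {n : ℕ} {Ω : Type*} [MeasurableSpace Ω] (P : Measure Ω)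
    (Y : Ω → Fin n → ℝ) (g : Ω → ℂ) (γ : Fin n → ℕ) (ξ : Fin n → ℝ) : ℂ :=
  ∫ ω, Complex.exp (-(Complex.I * ((∑ j, Y ω j * ξ j : ℝ) : ℂ))) *
    ((∏ j, (-(Complex.I * (Y ω j : ℂ))) ^ γ j) * g ω) ∂P

theorem PhiT_norm_aux {n : ℕ} (y : Fin n → ℝ) (γ : Fin n → ℕ) (ξ : Fin n → ℝ) (z : ℂ)
    (hz : ‖z‖ ≤ 1) :
    ‖Complex.exp (-(Complex.I * ((∑ j, y j * ξ j : ℝ) : ℂ))) *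
      ((∏ j, (-(Complex.I * (y j : ℂ))) ^ γ j) * z)‖ ≤ ∏ j, |y j| ^ γ j := by
  rw [norm_mul, norm_mul, norm_prod, Complex.norm_exp]
  have h0 : (-(Complex.I * ((∑ j, y j * ξ j : ℝ) : ℂ))).re = 0 := by
    rw [Complex.neg_re, Complex.I_mul_re, Complex.ofReal_im]; simp
  rw [h0, Real.exp_zero, one_mul]
  have h1 : ∀ j, ‖(-(Complex.I * (y j : ℂ))) ^ γ j‖ = |y j| ^ γ j := by
    intro j; simp
  simp_rw [h1]
  exact mul_le_of_le_one_right (Finset.prod_nonneg fun j _ => by positivity) hz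

theorem PhiT_meas {n : ℕ} {Ω : Type*} [MeasurableSpace Ω] (P : Measure Ω)
    (Y : Ω → Fin n → ℝ) (hY : Measurable Y) (g : Ω → ℂ) (hg : AEStronglyMeasurable g P)
    (γ : Fin n → ℕ) (ξ : Fin n → ℝ) :
    AEStronglyMeasurable (fun ω => Complex.exp (-(Complex.I * ((∑ j, Y ω j * ξ j : ℝ) : ℂ))) *
      ((∏ j, (-(Complex.I * (Y ω j : ℂ))) ^ γ j) * g ω)) P := by
  have hYj : ∀ j, Measurable fun ω => Y ω j := fun j => (measurable_pi_apply j).comp hY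
  refine AEStronglyMeasurable.mul (Measurable.aestronglyMeasurable ?_)
    (AEStronglyMeasurable.mul (Measurable.aestronglyMeasurable ?_) hg)
  · fun_prop
  · fun_prop

theorem pd_PhiT {n : ℕ} {Ω : Type*} [MeasurableSpace Ω] (P : Measure Ω)
    (Y : Ω → Fin n → ℝ) (hY : Measurable Y) (g : Ω → ℂ) (hg : AEStronglyMeasurable g P)
    (hg1 : ∀ ω, ‖g ω‖ ≤ 1)
    (hint : ∀ γ : Fin n → ℕ, Integrable (fun ω => ∏ j, |Y ω j| ^ γ j) P)
    (γ : Fin n → ℕ) (i : Fin n) :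
    pd i (PhiT P Y g γ) = PhiT P Y g (γ + Pi.single i 1) := by
  funext ξ
  obtain ⟨Q, hQ⟩ : ∃ Q : (Fin n → ℕ) → ℝ → Ω → ℂ, Q = fun γ s ω => Complex.exp (-(Complex.I *
      ((∑ j, Y ω j * (Function.update ξ i s) j : ℝ) : ℂ))) *
      ((∏ j, (-(Complex.I * (Y ω j : ℂ))) ^ γ j) * g ω) := ⟨_, rfl⟩
  have hQm : ∀ γ s, AEStronglyMeasurable (Q γ s) P := fun γ s => by
    rw [hQ]; exact PhiT_meas P Y hY g hg γ (Function.update ξ i s)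
  have hQb : ∀ γ s ω, ‖Q γ s ω‖ ≤ ∏ j, |Y ω j| ^ γ j := fun γ s ω => by
    rw [hQ]; exact PhiT_norm_aux (Y ω) γ (Function.update ξ i s) (g ω) (hg1 ω)
  have hQi : ∀ γ s, Integrable (Q γ s) P := fun γ s =>
    (hint γ).mono' (hQm γ s) (Filter.Eventually.of_forall (hQb γ s))
  obtain ⟨γ', hγ'⟩ : ∃ γ' : Fin n → ℕ, γ' = γ + Pi.single i 1 := ⟨_, rfl⟩
  rw [← hγ']
  suffices hQd : ∀ ω s, HasDerivAt (fun s => Q γ s ω) (Q γ' s ω) s by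
    have key : HasDerivAt (fun s => ∫ ω, Q γ s ω ∂P) (∫ ω, Q γ' (ξ i) ω ∂P) (ξ i) :=
      (hasDerivAt_integral_of_dominated_loc_of_deriv_le (μ := P) (x₀ := ξ i)
      (s := Set.univ) (bound := fun ω => ∏ j, |Y ω j| ^ γ' j)
      (F := Q γ) (F' := Q γ') Filter.univ_mem
      (Filter.Eventually.of_forall fun s => hQm γ s) (hQi γ (ξ i)) (hQm γ' (ξ i))
      (Filter.Eventually.of_forall fun ω s _ => hQb γ' s ω)
      (hint γ')
      (Filter.Eventually.of_forall fun ω s _ => hQd ω s)).2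
    have := key.deriv
    simp only [hQ, Function.update_eq_self] at this
    exact this
  intro ω s
  simp only [hQ, hγ']
  have e1 : ∏ j, (-(Complex.I * (Y ω j : ℂ))) ^ (γ + (Pi.single i 1 : Fin n → ℕ)) j =
      (∏ j, (-(Complex.I * (Y ω j : ℂ))) ^ γ j) * (-(Complex.I * (Y ω i : ℂ))) := by
    simp only [Pi.add_apply, pow_add, Finset.prod_mul_distrib]
    congr 1
    rw [Finset.prod_eq_single i]
    · simp
    · intro b _ hb; simp [hb]
    · simp
  have e2 : ∀ s : ℝ, (∑ j, Y ω j * (Function.update ξ i s) j : ℝ) =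
      Y ω i * s + ∑ j ∈ Finset.univ.erase i, Y ω j * ξ j := by
    intro s
    rw [← Finset.add_sum_erase _ _ (Finset.mem_univ i)]
    congr 1
    · simp
    · refine Finset.sum_congr rfl fun j hj => ?_
      rw [Function.update_of_ne (Finset.ne_of_mem_erase hj)]
  rw [e1]
  simp only [e2]
  have d1 : HasDerivAt (fun s : ℝ => Y ω i * s + ∑ j ∈ Finset.univ.erase i, Y ω j * ξ j)
      (Y ω i) s := by
    simpa using ((hasDerivAt_id s).const_mul (Y ω i)).add_const
      (∑ j ∈ Finset.univ.erase i, Y ω j * ξ j)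
  have d2 := ((d1.ofReal_comp.const_mul Complex.I).neg.cexp).mul_const
    ((∏ j, (-(Complex.I * (Y ω j : ℂ))) ^ γ j) * g ω)
  refine d2.congr_deriv ?_
  simp only [Pi.neg_apply]
  ring

theorem iter_PhiT {n : ℕ} {Ω : Type*} [MeasurableSpace Ω] (P : Measure Ω)
    (Y : Ω → Fin n → ℝ) (hY : Measurable Y) (g : Ω → ℂ) (hg : AEStronglyMeasurable g P)
    (hg1 : ∀ ω, ‖g ω‖ ≤ 1)
    (hint : ∀ γ : Fin n → ℕ, Integrable (fun ω => ∏ j, |Y ω j| ^ γ j) P)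
    (i : Fin n) (k : ℕ) (γ : Fin n → ℕ) :
    (pd i)^[k] (PhiT P Y g γ) = PhiT P Y g (γ + Pi.single i k) := by
  induction k with
  | zero => simp
  | succ k ih =>
    rw [Function.iterate_succ_apply', ih, pd_PhiT P Y hY g hg hg1 hint, add_assoc,
      ← Pi.single_add]

theorem mderiv_PhiT {n : ℕ} {Ω : Type*} [MeasurableSpace Ω] (P : Measure Ω)
    (Y : Ω → Fin n → ℝ) (hY : Measurable Y) (g : Ω → ℂ) (hg : AEStronglyMeasurable g P)
    (hg1 : ∀ ω, ‖g ω‖ ≤ 1)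
    (hint : ∀ γ : Fin n → ℕ, Integrable (fun ω => ∏ j, |Y ω j| ^ γ j) P)
    (β : Fin n → ℕ) :
    mderiv β (PhiT P Y g 0) = PhiT P Y g β := by
  have h : ∀ l : List (Fin n), l.foldr (fun j g => (pd j)^[β j] g) (PhiT P Y g 0) =
      PhiT P Y g (l.map fun j => (Pi.single j (β j) : Fin n → ℕ)).sum := by
    intro l
    induction l with
    | nil => simp
    | cons a l ih =>
      rw [List.foldr_cons, ih, iter_PhiT P Y hY g hg hg1 hint, List.map_cons, List.sum_cons,
        add_comm]
  rw [mderiv, h, Finset.sum_map_toList, Finset.univ_sum_single]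

theorem expNeg_norm_le (L : ENNReal) : ‖((expNeg L : ℝ) : ℂ)‖ ≤ 1 := by
  rw [Complex.norm_real, expNeg]
  split_ifs
  · simp
  · rw [Real.norm_eq_abs, abs_of_pos (Real.exp_pos _), Real.exp_le_one_iff]
    simp

/-- For every `t ∈ (0,T]`, every multi-index `β` and all `x, ξ`,
`|∂_ξ^β u(x,ξ,t)| ≤ t^{|β|/2} ∏_j A_{β_j}` where `A_k = 2^{k/2} Γ((k+1)/2)/√π`. -/
theorem weyl_symbol_xi_deriv_bound
    (n : ℕ) (hn : 1 ≤ n) (T : ℝ) (hT : 0 < T)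
    {Ω : Type*} [MeasurableSpace Ω] (P : Measure Ω) [IsProbabilityMeasure P]
    (W : ℝ → Ω → Fin n → ℝ) (hW : IsBrownian n T P W)
    (V : (Fin n → ℝ) → ℝ) (hV0 : ∀ y, 0 ≤ V y) (hVmeas : Measurable V)
    (t : ℝ) (ht : t ∈ Set.Ioc (0 : ℝ) T) (β : Fin n → ℕ) (x ξ : Fin n → ℝ) :
    ‖mderiv β (fun ξ' : Fin n → ℝ => uSym P W V t x ξ') ξ‖ ≤
      t ^ (((∑ j, β j : ℕ) : ℝ) / 2) * ∏ j, A (β j) := by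
  obtain ⟨ht0, htT⟩ := ht
  set Y : Ω → Fin n → ℝ := fun ω j => W t ω j - W 0 ω j with hYdef
  have hYj : ∀ j, Measurable fun ω => Y ω j := fun j =>
    ((measurable_pi_apply j).comp (hW.meas t)).sub ((measurable_pi_apply j).comp (hW.meas 0))
  have hY : Measurable Y := measurable_pi_lambda _ hYj
  have hlaw : P.map Y = Measure.pi (fun _ : Fin n => gaussianReal 0 t.toNNReal) := by
    have h := (hW.coordIndep 0 t le_rfl ht0.le htT).map_fun_eq_pi_map
      (fun j => (hYj j).aemeasurable)
    rw [show (fun ω i => W t ω i - W 0 ω i) = Y from rfl] at h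
    rw [h]
    congr 1
    funext j
    rw [hW.gaussCoord 0 t le_rfl ht0.le htT j, sub_zero]
  have hpm : ∀ γ : Fin n → ℕ, Measurable fun y : Fin n → ℝ => ∏ j, |y j| ^ γ j := by
    intro γ; fun_prop
  have hint : ∀ γ : Fin n → ℕ, Integrable (fun ω => ∏ j, |Y ω j| ^ γ j) P := by
    intro γ
    have h : Integrable (fun y : Fin n → ℝ => ∏ j, |y j| ^ γ j) (P.map Y) := by
      rw [hlaw]
      exact Integrable.fintype_prod (f := fun j (y : ℝ) => |y| ^ γ j)
        (fun j => gauss_abs_integrable _ _)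
    exact h.comp_measurable hY
  have hmom : ∫ ω, ∏ j, |Y ω j| ^ β j ∂P =
      t ^ (((∑ j, β j : ℕ) : ℝ) / 2) * ∏ j, A (β j) := by
    have h : ∫ y, ∏ j, |y j| ^ β j ∂(P.map Y) = ∫ ω, ∏ j, |Y ω j| ^ β j ∂P :=
      integral_map hY.aemeasurable (hpm β).aestronglyMeasurable
    rw [← h, hlaw, integral_fintype_prod_eq_prod (fun j (y : ℝ) => |y| ^ β j)]
    have hv : t.toNNReal ≠ 0 := by simpa using ht0
    simp_rw [gauss_abs_moment _ hv]
    rw [Finset.prod_mul_distrib, Real.coe_toNNReal _ ht0.le, ← Real.rpow_sum_of_pos ht0,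
      ← Finset.sum_div, Nat.cast_sum]
  have hYW : ∀ᵐ ω ∂P, W t ω = Y ω := by
    filter_upwards [hW.start] with ω hω
    funext j
    simp [hYdef, hω]
  -- the potential factor
  set G : Ω → ℂ := fun ω => ((expNeg (∫⁻ s in Set.Ioc (0 : ℝ) t,
        ENNReal.ofReal (V (fun j => x j - W t ω j / 2 + W s ω j))) : ℝ) : ℂ) with hG
  have hu : ∃ g : Ω → ℂ, AEStronglyMeasurable g P ∧ (∀ ω, ‖g ω‖ ≤ 1) ∧
      (fun ξ' : Fin n → ℝ => uSym P W V t x ξ') = PhiT P Y g 0 := by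
    have hcongr : ∀ ξ', uSym P W V t x ξ' =
        ∫ ω, Complex.exp (-(Complex.I * ((∑ j, Y ω j * ξ' j : ℝ) : ℂ))) * G ω ∂P := by
      intro ξ'
      refine integral_congr_ae ?_
      filter_upwards [hYW] with ω hω
      simp only [FK, hG, ← hω]
    by_cases hGm : AEStronglyMeasurable G P
    · refine ⟨G, hGm, fun ω => expNeg_norm_le _, ?_⟩
      funext ξ'
      simp only [hcongr, PhiT, Pi.zero_apply, pow_zero, Finset.prod_const_one, one_mul]
    · refine ⟨0, aestronglyMeasurable_const, fun ω => by simp, ?_⟩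
      funext ξ'
      have hz : PhiT P Y 0 0 ξ' = 0 := by simp [PhiT]
      rw [hz, hcongr]
      refine integral_non_aestronglyMeasurable fun hcon => hGm ?_
      have hE : AEStronglyMeasurable
          (fun ω => Complex.exp (Complex.I * ((∑ j, Y ω j * ξ' j : ℝ) : ℂ))) P := by
        refine Measurable.aestronglyMeasurable ?_
        fun_prop
      refine (hE.mul hcon).congr (Filter.Eventually.of_forall fun ω => ?_)
      simp only [Pi.mul_apply]
      rw [← mul_assoc, ← Complex.exp_add, add_neg_cancel, Complex.exp_zero, one_mul]
  obtain ⟨g, hg, hg1, hu⟩ := hu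
  rw [hu, mderiv_PhiT P Y hY g hg hg1 hint, ← hmom]
  exact norm_integral_le_of_norm_le (hint β)
    (Filter.Eventually.of_forall fun ω => PhiT_norm_aux _ _ _ _ (hg1 ω))
end

section
/- Suppose in addition that ∫_{ℝⁿ} e^{−tV(x)} dx < ∞ for a given t ∈ (0,T]. Then for every ξ ∈ ℝⁿ the function x ↦ u(x,ξ,t) is integrable on ℝⁿ and ∫_{ℝⁿ} |u(x,ξ,t)| dx ≤ ∫_{ℝⁿ} e^{−tV(x)} dx. -/
open MeasureTheory ProbabilityTheory

lemma aux_jensen (t : ℝ) (ht : 0 < t) (f : ℝ → ℝ) (hf : Measurable f) (hf0 : ∀ s, 0 ≤ f s) :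
    ENNReal.ofReal (expNeg (∫⁻ s in Set.Ioc (0 : ℝ) t, ENNReal.ofReal (f s))) ≤
      (ENNReal.ofReal t)⁻¹ *
        ∫⁻ s in Set.Ioc (0 : ℝ) t, ENNReal.ofReal (Real.exp (-(t * f s))) := by
  set L := ∫⁻ s in Set.Ioc (0 : ℝ) t, ENNReal.ofReal (f s) with hL
  unfold expNeg
  split_ifs with h
  · simp
  · have hfi : Integrable f (volume.restrict (Set.Ioc (0 : ℝ) t)) := by
      refine ⟨hf.aestronglyMeasurable, ?_⟩
      rw [hasFiniteIntegral_iff_ofReal (Filter.Eventually.of_forall hf0)]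
      exact lt_top_iff_ne_top.2 h
    have hI : L.toReal = ∫ s in Set.Ioc (0 : ℝ) t, f s := by
      rw [integral_eq_lintegral_of_nonneg_ae (Filter.Eventually.of_forall hf0)
        hf.aestronglyMeasurable]
    set l := L.toReal with hl
    have hei : Integrable (fun s => Real.exp (-(t * f s)))
        (volume.restrict (Set.Ioc (0 : ℝ) t)) := by
      refine Integrable.of_bound (C := 1) (by fun_prop) (Filter.Eventually.of_forall fun s => ?_)
      rw [Real.norm_eq_abs, abs_of_pos (Real.exp_pos _), Real.exp_le_one_iff]
      have := mul_nonneg ht.le (hf0 s)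
      linarith
    have hti : Integrable (fun s => Real.exp (-l) * (1 + l - t * f s))
        (volume.restrict (Set.Ioc (0 : ℝ) t)) :=
      ((integrable_const (1 + l)).sub (hfi.const_mul t)).const_mul _
    have hle : t * Real.exp (-l) ≤ ∫ s in Set.Ioc (0 : ℝ) t, Real.exp (-(t * f s)) := by
      calc t * Real.exp (-l)
          = ∫ s in Set.Ioc (0 : ℝ) t, Real.exp (-l) * (1 + l - t * f s) := by
            rw [integral_const_mul, integral_sub (integrable_const _) (hfi.const_mul t),
              integral_const_mul, ← hI]
            simp [ht.le]
            ring
        _ ≤ _ := by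
            refine integral_mono hti hei fun s => ?_
            have h1 : Real.exp (-(t * f s)) = Real.exp (-l) * Real.exp (l - t * f s) := by
              rw [← Real.exp_add]; congr 1; ring
            simp only [h1]
            have := Real.add_one_le_exp (l - t * f s)
            exact mul_le_mul_of_nonneg_left (by linarith) (Real.exp_pos _).le
    rw [← ofReal_integral_eq_lintegral_ofReal hei
      (Filter.Eventually.of_forall fun s => (Real.exp_pos _).le),
      ← ENNReal.ofReal_inv_of_pos ht, ← ENNReal.ofReal_mul (by positivity)]
    apply ENNReal.ofReal_le_ofReal
    rw [inv_mul_eq_div, le_div_iff₀ ht]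
    linarith

lemma aux_trans {n : ℕ} (g : (Fin n → ℝ) → ENNReal) (a b : Fin n → ℝ) :
    ∫⁻ x : Fin n → ℝ, g (fun j => x j - a j / 2 + b j) = ∫⁻ y, g y := by
  rw [← lintegral_add_right_eq_self g (fun j => - (a j / 2) + b j)]
  refine lintegral_congr fun x => ?_
  congr 1
  funext j
  simp only [Pi.add_apply]
  ring

lemma aux_swap {α β : Type*} [MeasurableSpace α] [MeasurableSpace β] (μ : Measure α)
    (ν : Measure β) [SFinite μ] [SFinite ν] (F : α → β → ENNReal)
    (hF : Measurable (fun q : α × β => F q.1 q.2)) :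
    ∫⁻ x, ∫⁻ s, F x s ∂ν ∂μ = ∫⁻ s, ∫⁻ x, F x s ∂μ ∂ν :=
  lintegral_lintegral_swap (f := F) hF.aemeasurable

lemma aux_swap2 {n : ℕ} (t : ℝ) (F : (Fin n → ℝ) → ℝ → ENNReal)
    (hF : Measurable (fun q : (Fin n → ℝ) × ℝ => F q.1 q.2)) :
    ∫⁻ x : Fin n → ℝ, ∫⁻ s in Set.Ioc (0 : ℝ) t, F x s =
      ∫⁻ s in Set.Ioc (0 : ℝ) t, ∫⁻ x : Fin n → ℝ, F x s := aux_swap _ _ F hF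

lemma aux_swap3 {n : ℕ} (t : ℝ) (g : (Fin n → ℝ) → ENNReal) (a : Fin n → ℝ)
    (w : ℝ → Fin n → ℝ)
    (hF : Measurable (fun q : (Fin n → ℝ) × ℝ => g (fun j => q.1 j - a j / 2 + w q.2 j))) :
    ∫⁻ x : Fin n → ℝ, ∫⁻ s in Set.Ioc (0 : ℝ) t, g (fun j => x j - a j / 2 + w s j) =
      ∫⁻ s in Set.Ioc (0 : ℝ) t, ∫⁻ x : Fin n → ℝ, g (fun j => x j - a j / 2 + w s j) :=
  aux_swap2 t (fun x s => g (fun j => x j - a j / 2 + w s j)) hF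

lemma aux_inner {n : ℕ} (t : ℝ) (ht0 : 0 < t) (V : (Fin n → ℝ) → ℝ) (hV0 : ∀ y, 0 ≤ V y)
    (hVmeas : Measurable V) (a : Fin n → ℝ) (w : ℝ → Fin n → ℝ)
    (hargω : Measurable (fun q : (Fin n → ℝ) × ℝ =>
      (fun j => q.1 j - a j / 2 + w q.2 j : Fin n → ℝ))) :
    ∫⁻ x : Fin n → ℝ, ENNReal.ofReal (expNeg (∫⁻ s in Set.Ioc (0 : ℝ) t,
        ENNReal.ofReal (V (fun j => x j - a j / 2 + w s j)))) ≤
      ∫⁻ y : Fin n → ℝ, ENNReal.ofReal (Real.exp (-(t * V y))) := by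
  set g : (Fin n → ℝ) → ENNReal := fun y => ENNReal.ofReal (Real.exp (-(t * V y))) with hgdef
  have hg : Measurable g := by rw [hgdef]; fun_prop
  have hc : Measurable (fun q : (Fin n → ℝ) × ℝ => g (fun j => q.1 j - a j / 2 + w q.2 j)) :=
    hg.comp hargω
  have h1 : ∀ x : Fin n → ℝ, ENNReal.ofReal (expNeg (∫⁻ s in Set.Ioc (0 : ℝ) t,
        ENNReal.ofReal (V (fun j => x j - a j / 2 + w s j)))) ≤
      (ENNReal.ofReal t)⁻¹ * ∫⁻ s in Set.Ioc (0 : ℝ) t, g (fun j => x j - a j / 2 + w s j) := by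
    intro x
    have hx : Measurable (fun s : ℝ => V (fun j => x j - a j / 2 + w s j)) :=
      hVmeas.comp (hargω.comp (f := fun s : ℝ => (x, s)) (by fun_prop))
    exact aux_jensen t ht0 (fun s => V (fun j => x j - a j / 2 + w s j)) hx fun s => hV0 _
  have h2 : ∫⁻ x : Fin n → ℝ, ∫⁻ s in Set.Ioc (0 : ℝ) t, g (fun j => x j - a j / 2 + w s j) =
      ∫⁻ s in Set.Ioc (0 : ℝ) t, ∫⁻ x : Fin n → ℝ, g (fun j => x j - a j / 2 + w s j) :=
    aux_swap3 t g a w hc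
  have h3 : ∀ s, ∫⁻ x : Fin n → ℝ, g (fun j => x j - a j / 2 + w s j) = ∫⁻ y, g y :=
    fun s => aux_trans g a (w s)
  have hti : (ENNReal.ofReal t)⁻¹ ≠ ⊤ := by simpa using ht0
  have ht1 : ENNReal.ofReal t ≠ 0 := by simpa using ht0
  have h4 : ∫⁻ s in Set.Ioc (0 : ℝ) t, ∫⁻ x : Fin n → ℝ, g (fun j => x j - a j / 2 + w s j) =
      (∫⁻ y, g y) * ENNReal.ofReal t := by
    rw [lintegral_congr h3, setLIntegral_const, Real.volume_Ioc, sub_zero]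
  have h5 : (ENNReal.ofReal t)⁻¹ * ((∫⁻ y, g y) * ENNReal.ofReal t) = ∫⁻ y, g y := by
    generalize (∫⁻ y, g y) = c
    rw [mul_comm, mul_assoc, ENNReal.mul_inv_cancel ht1 ENNReal.ofReal_ne_top, mul_one]
  calc _ ≤ ∫⁻ x : Fin n → ℝ, (ENNReal.ofReal t)⁻¹ *
          ∫⁻ s in Set.Ioc (0 : ℝ) t, g (fun j => x j - a j / 2 + w s j) := lintegral_mono h1
    _ = (ENNReal.ofReal t)⁻¹ * ∫⁻ x : Fin n → ℝ,
          ∫⁻ s in Set.Ioc (0 : ℝ) t, g (fun j => x j - a j / 2 + w s j) :=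
        lintegral_const_mul' _ _ hti
    _ = ∫⁻ y, g y := by rw [h2, h4, h5]

lemma expNeg_meas : Measurable expNeg := by
  unfold expNeg
  exact Measurable.ite (measurableSet_singleton _) measurable_const (by fun_prop)

lemma aux_modif {n : ℕ} {T : ℝ} (hT : 0 < T) {Ω : Type*} [MeasurableSpace Ω] {P : Measure Ω}
    {W : ℝ → Ω → Fin n → ℝ} (hW : IsBrownian n T P W) :
    ∃ W' : ℝ → Ω → Fin n → ℝ, Measurable (fun p : ℝ × Ω => W' p.1 p.2) ∧
      ∀ᵐ ω ∂P, ∀ s ∈ Set.Icc 0 T, W' s ω = W s ω := by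
  classical
  set N := toMeasurable P {ω | ¬ ContinuousOn (fun s => W s ω) (Set.Icc 0 T)} with hN
  have hNm : MeasurableSet N := measurableSet_toMeasurable _ _
  have hN0 : P N = 0 := by rw [hN, measure_toMeasurable]; exact hW.cont
  refine ⟨fun s ω => if ω ∈ N then 0 else W (Set.projIcc 0 T hT.le s) ω, ?_, ?_⟩
  · refine measurable_uncurry_of_continuous_of_measurable
      (u := fun s ω => if ω ∈ N then 0 else W (Set.projIcc 0 T hT.le s) ω) ?_ ?_
    · intro ω
      by_cases h : ω ∈ N
      · simp only [h, if_true]; exact continuous_const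
      · simp only [h, if_false]
        have hc : ContinuousOn (fun s => W s ω) (Set.Icc 0 T) := by
          by_contra hc
          exact h (subset_toMeasurable _ _ hc)
        exact (continuousOn_iff_continuous_domRestrict.1 hc).comp continuous_projIcc
    · intro s
      exact Measurable.ite hNm measurable_const (hW.meas _)
  · filter_upwards [measure_eq_zero_iff_ae_notMem.1 hN0] with ω hω s hs
    simp only [hω, if_false, Set.projIcc_of_mem hT.le hs]

/-- If `∫_{ℝⁿ} e^{-tV(x)} dx < ∞` for a given `t ∈ (0,T]`, then for every
`ξ ∈ ℝⁿ` the function `x ↦ u(x,ξ,t)` is integrable on `ℝⁿ` and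
`∫_{ℝⁿ} |u(x,ξ,t)| dx ≤ ∫_{ℝⁿ} e^{-tV(x)} dx`. -/
theorem weyl_symbol_L1_in_x
    (n : ℕ) (hn : 1 ≤ n) (T : ℝ) (hT : 0 < T)
    {Ω : Type*} [MeasurableSpace Ω] (P : Measure Ω) [IsProbabilityMeasure P]
    (W : ℝ → Ω → Fin n → ℝ) (hW : IsBrownian n T P W)
    (V : (Fin n → ℝ) → ℝ) (hV0 : ∀ y, 0 ≤ V y) (hVmeas : Measurable V)
    (t : ℝ) (ht : t ∈ Set.Ioc (0 : ℝ) T)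
    (hInt : Integrable (fun y : Fin n → ℝ => Real.exp (-(t * V y))))
    (ξ : Fin n → ℝ) :
    Integrable (fun x : Fin n → ℝ => uSym P W V t x ξ) ∧
      ∫ x : Fin n → ℝ, ‖uSym P W V t x ξ‖ ≤ ∫ y : Fin n → ℝ, Real.exp (-(t * V y)) := by
  obtain ⟨W', hm, hWW⟩ := aux_modif hT hW
  have ht0 : 0 < t := ht.1
  have hFK : ∀ x, FK W V t x ξ =ᵐ[P] FK W' V t x ξ := by
    intro x
    filter_upwards [hWW] with ω hω
    unfold FK
    rw [hω t ⟨ht.1.le, ht.2⟩]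
    congr 3
    refine setLIntegral_congr_fun measurableSet_Ioc fun s hs => ?_
    simp only [hω s ⟨hs.1.le, hs.2.trans ht.2⟩]
  have hu : ∀ x, uSym P W V t x ξ = ∫ ω, FK W' V t x ξ ω ∂P := fun x =>
    integral_congr_ae (hFK x)
  have hmt : Measurable (W' t) := hm.comp (measurable_const.prodMk measurable_id)
  have hmc : ∀ j, Measurable (fun p : ℝ × Ω => W' p.1 p.2 j) := fun j =>
    (measurable_pi_apply j).comp hm
  have hmtc : ∀ j, Measurable (fun ω => W' t ω j) := fun j => (measurable_pi_apply j).comp hmt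
  -- the argument of V
  have harg : Measurable (fun q : ((Fin n → ℝ) × Ω) × ℝ =>
      (fun j => q.1.1 j - W' t q.1.2 j / 2 + W' q.2 q.1.2 j : Fin n → ℝ)) := by
    refine measurable_pi_lambda _ fun j => ?_
    have h1 : Measurable (fun q : ((Fin n → ℝ) × Ω) × ℝ => q.1.1 j) := by fun_prop
    have h2 : Measurable (fun q : ((Fin n → ℝ) × Ω) × ℝ => W' t q.1.2 j) :=
      (hmtc j).comp (by fun_prop)
    have h3 : Measurable (fun q : ((Fin n → ℝ) × Ω) × ℝ => W' q.2 q.1.2 j) :=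
      (hmc j).comp (g := fun p : ℝ × Ω => W' p.1 p.2 j)
        (f := fun q : ((Fin n → ℝ) × Ω) × ℝ => (q.2, q.1.2)) (by fun_prop)
    exact (h1.sub (h2.div_const 2)).add h3
  have hL : Measurable (fun p : (Fin n → ℝ) × Ω => expNeg (∫⁻ s in Set.Ioc (0 : ℝ) t,
        ENNReal.ofReal (V (fun j => p.1 j - W' t p.2 j / 2 + W' s p.2 j)))) := by
    refine expNeg_meas.comp ?_
    exact Measurable.lintegral_prod_right' (f := fun q : ((Fin n → ℝ) × Ω) × ℝ =>
      ENNReal.ofReal (V (fun j => q.1.1 j - W' t q.1.2 j / 2 + W' q.2 q.1.2 j)))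
      (hVmeas.comp harg).ennreal_ofReal
  have hFKm : Measurable (fun p : (Fin n → ℝ) × Ω => FK W' V t p.1 ξ p.2) := by
    unfold FK
    refine Measurable.mul ?_ (Complex.measurable_ofReal.comp hL)
    have : Measurable (fun p : (Fin n → ℝ) × Ω => ∑ j, W' t p.2 j * ξ j) :=
      Finset.measurable_sum _ fun j _ => ((hmtc j).comp measurable_snd).mul_const _
    exact Complex.measurable_exp.comp
      ((Complex.measurable_ofReal.comp this).const_mul _).neg
  have hexp0 : ∀ L, 0 ≤ expNeg L := by
    intro L; unfold expNeg; split_ifs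
    · exact le_rfl
    · positivity
  have hnorm : ∀ x ω, ‖FK W' V t x ξ ω‖ₑ = ENNReal.ofReal (expNeg (∫⁻ s in Set.Ioc (0 : ℝ) t,
        ENNReal.ofReal (V (fun j => x j - W' t ω j / 2 + W' s ω j)))) := by
    intro x ω
    rw [← ofReal_norm]
    congr 1
    unfold FK
    rw [norm_mul, Complex.norm_exp, Complex.norm_real, Real.norm_eq_abs, abs_of_nonneg (hexp0 _)]
    simp
  have hfun : (fun x : Fin n → ℝ => uSym P W V t x ξ) =
      fun x => ∫ ω, FK W' V t x ξ ω ∂P := funext hu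
  have hsm : AEStronglyMeasurable (fun x : Fin n → ℝ => uSym P W V t x ξ) volume := by
    rw [hfun]
    exact (StronglyMeasurable.integral_prod_right'
      (f := fun p : (Fin n → ℝ) × Ω => FK W' V t p.1 ξ p.2)
      hFKm.stronglyMeasurable).aestronglyMeasurable
  have hg : Measurable (fun y : Fin n → ℝ => ENNReal.ofReal (Real.exp (-(t * V y)))) := by
    fun_prop
  have hkey : ∫⁻ x : Fin n → ℝ, ‖uSym P W V t x ξ‖ₑ ≤
      ∫⁻ y : Fin n → ℝ, ENNReal.ofReal (Real.exp (-(t * V y))) := by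
    calc ∫⁻ x : Fin n → ℝ, ‖uSym P W V t x ξ‖ₑ
        ≤ ∫⁻ x : Fin n → ℝ, ∫⁻ ω, ‖FK W' V t x ξ ω‖ₑ ∂P := by
          refine lintegral_mono fun x => ?_
          simp only [hu x]
          exact enorm_integral_le_lintegral_enorm _
      _ = ∫⁻ ω, (∫⁻ x : Fin n → ℝ, ‖FK W' V t x ξ ω‖ₑ) ∂P :=
          lintegral_lintegral_swap (f := fun x ω => ‖FK W' V t x ξ ω‖ₑ)
            hFKm.enorm.aemeasurable
      _ ≤ ∫⁻ ω, (∫⁻ y : Fin n → ℝ, ENNReal.ofReal (Real.exp (-(t * V y)))) ∂P := by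
          refine lintegral_mono fun ω => ?_
          have hargω : Measurable (fun q : (Fin n → ℝ) × ℝ =>
              (fun j => q.1 j - W' t ω j / 2 + W' q.2 ω j : Fin n → ℝ)) :=
            harg.comp (f := fun q : (Fin n → ℝ) × ℝ => ((q.1, ω), q.2)) (by fun_prop)
          have hb := aux_inner t ht0 V hV0 hVmeas (W' t ω) (fun s => W' s ω) hargω
          simp only [hnorm]
          exact hb
      _ = _ := by simp
  have hfin : ∫⁻ y : Fin n → ℝ, ENNReal.ofReal (Real.exp (-(t * V y))) < ⊤ := by
    have := hInt.2
    rwa [hasFiniteIntegral_iff_ofReal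
      (Filter.Eventually.of_forall fun y => (Real.exp_pos _).le)] at this
  refine ⟨⟨hsm, hkey.trans_lt hfin⟩, ?_⟩
  rw [integral_norm_eq_lintegral_enorm hsm, integral_eq_lintegral_of_nonneg_ae
    (Filter.Eventually.of_forall fun y => (Real.exp_pos _).le) hInt.1]
  exact ENNReal.toReal_mono hfin.ne hkey
end

section
/- (Multivariate Faà di Bruno formula for the exponential, after Constantine–Savits.) Let W : ℝⁿ → ℝ be C^∞ and let α ∈ ℕⁿ be a nonzero multi-index. Then for every x ∈ ℝⁿ, ∂^α (e^{W})(x) = α! · e^{W(x)} · Σ_{φ ∈ F(α)} Π_{0 ≠ β ≤ α} (1/φ(β)!) · ( ∂^β W(x) / β! )^{φ(β)}. -/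
open MeasureTheory ProbabilityTheory

set_option linter.unusedSectionVars false

section helpers
variable {ι : Type*} [Fintype ι] [DecidableEq ι]

/-- finsupp version of the index set -/
noncomputable def FS (α : ι → ℕ) : Finset ((ι → ℕ) →₀ ℕ) :=
  (Finset.finsupp (lowerMulti α) (fun _ => Finset.range (∑ i, α i + 1))).filter
    (fun φ => φ.sum (fun β k => k • β) = α)

lemma mem_lowerMulti {α β : ι → ℕ} : β ∈ lowerMulti α ↔ β ≠ 0 ∧ β ≤ α := by
  simp [lowerMulti]

lemma FS_aux {α : ι → ℕ} {φ : (ι → ℕ) →₀ ℕ} (h : φ.sum (fun β k => k • β) = α)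
    (β : ι → ℕ) : φ β • β ≤ α := by
  by_cases hβ : φ β = 0
  · rw [hβ, zero_smul]; exact fun i => Nat.zero_le _
  · rw [← h, Finsupp.sum]
    exact Finset.single_le_sum (f := fun β => φ β • β) (fun γ _ i => Nat.zero_le _)
      (Finsupp.mem_support_iff.2 hβ)

lemma mem_FS {α : ι → ℕ} {φ : (ι → ℕ) →₀ ℕ} :
    φ ∈ FS α ↔ φ 0 = 0 ∧ φ.sum (fun β k => k • β) = α := by
  rw [FS, Finset.mem_filter, Finset.mem_finsupp_iff]
  constructor
  · rintro ⟨⟨h1, -⟩, h⟩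
    refine ⟨?_, h⟩
    by_contra h0
    exact (mem_lowerMulti.1 (h1 (Finsupp.mem_support_iff.2 h0))).1 rfl
  · rintro ⟨h0, h⟩
    have key : φ.support ⊆ lowerMulti α := by
      intro β hβ
      have hβ := Finsupp.mem_support_iff.1 hβ
      refine mem_lowerMulti.2 ⟨?_, ?_⟩
      · rintro rfl; exact hβ h0
      · intro i
        have := FS_aux h β i
        simp only [Pi.smul_apply, smul_eq_mul] at this
        exact le_trans (Nat.le_mul_of_pos_left _ (Nat.pos_of_ne_zero hβ)) this
    refine ⟨⟨key, ?_⟩, h⟩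
    intro β hβ
    obtain ⟨i, hi⟩ := Function.ne_iff.1 (mem_lowerMulti.1 hβ).1
    have := FS_aux h β i
    simp only [Pi.smul_apply, smul_eq_mul] at this
    have h2 : φ β ≤ φ β * β i := Nat.le_mul_of_pos_right _ (Nat.pos_of_ne_zero hi)
    have h3 : α i ≤ ∑ i, α i := Finset.single_le_sum (fun _ _ => Nat.zero_le _) (Finset.mem_univ i)
    rw [Finset.mem_range]; omega

lemma FS_support {α : ι → ℕ} {φ : (ι → ℕ) →₀ ℕ} (h : φ ∈ FS α) : φ.support ⊆ lowerMulti α := by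
  rw [FS, Finset.mem_filter, Finset.mem_finsupp_iff] at h
  exact h.1.1

/-- term -/
noncomputable def tm (w : (ι → ℕ) → ℝ) (L : Finset (ι → ℕ)) (φ : (ι → ℕ) →₀ ℕ) : ℝ :=
  ∏ β ∈ L, (1 / ((φ β).factorial : ℝ)) * (w β) ^ (φ β)

lemma tm_subset (w : (ι → ℕ) → ℝ) {L : Finset (ι → ℕ)} {φ : (ι → ℕ) →₀ ℕ} (h : φ.support ⊆ L) :
    tm w L φ = tm w φ.support φ := by
  symm
  apply Finset.prod_subset h
  intro β _ hβ
  rw [Finsupp.notMem_support_iff.1 hβ]; simp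

/-- sum -/
noncomputable def SS (w : (ι → ℕ) → ℝ) (α : ι → ℕ) : ℝ := ∑ φ ∈ FS α, tm w (lowerMulti α) φ

/-- derivative of a term -/
noncomputable def dtm (w : (ι → ℕ) → ℝ) (L : Finset (ι → ℕ)) (φ : (ι → ℕ) →₀ ℕ) (β : ι → ℕ) : ℝ :=
  (∏ γ ∈ L.erase β, (1 / ((φ γ).factorial : ℝ)) * (w γ) ^ (φ γ)) *
    ((1 / ((φ β).factorial : ℝ)) * (φ β * (w β) ^ (φ β - 1)))

lemma dtm_mul (w : (ι → ℕ) → ℝ) (L : Finset (ι → ℕ)) (φ : (ι → ℕ) →₀ ℕ) {β : ι → ℕ} (hβ : β ∈ L) :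
    w β * dtm w L φ β = φ β * tm w L φ := by
  rw [dtm, tm, ← Finset.prod_erase_mul _ _ hβ]
  rcases Nat.eq_zero_or_pos (φ β) with h | h
  · simp [h]
  · obtain ⟨k, hk⟩ := Nat.exists_eq_succ_of_ne_zero h.ne'
    rw [hk]; simp only [Nat.succ_eq_add_one, Nat.add_sub_cancel, pow_succ]; ring

lemma dtm_add (w : (ι → ℕ) → ℝ) (L : Finset (ι → ℕ)) (φ : (ι → ℕ) →₀ ℕ) {β : ι → ℕ} (hβ : β ∈ L) :
    dtm w L (φ + Finsupp.single β 1) β = tm w L φ := by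
  rw [dtm, tm, ← Finset.prod_erase_mul _ _ hβ]
  congr 1
  · apply Finset.prod_congr rfl
    intro γ hγ
    have : β ≠ γ := (Finset.ne_of_mem_erase hγ).symm
    simp [this]
  · simp only [Finsupp.add_apply, Finsupp.single_eq_same, Nat.add_sub_cancel, Nat.factorial_succ]
    have : ((φ β : ℝ) + 1) ≠ 0 := by positivity
    have h2 : ((φ β).factorial : ℝ) ≠ 0 := by positivity
    push_cast
    field_simp

lemma sum_dtm (w : (ι → ℕ) → ℝ) {α β : ι → ℕ} (hβ : β ∈ lowerMulti α) :
    ∑ φ ∈ FS α, dtm w (lowerMulti α) φ β = SS w (α - β) := by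
  rw [SS]
  obtain ⟨hb0, hba⟩ := mem_lowerMulti.1 hβ
  have hsum : ∀ ψ : (ι → ℕ) →₀ ℕ, (ψ + Finsupp.single β 1).sum (fun β k => k • β)
      = ψ.sum (fun β k => k • β) + β := by
    intro ψ
    rw [Finsupp.sum_add_index' (by simp) (by intros; rw [add_smul])]
    simp
  symm
  have hsub : (FS (α - β)).image (fun φ => φ + Finsupp.single β 1) ⊆ FS α := by
    intro φ hφ
    obtain ⟨ψ, hψ, rfl⟩ := Finset.mem_image.1 hφ
    obtain ⟨h1, h2⟩ := mem_FS.1 hψ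
    refine mem_FS.2 ⟨by simp [h1, hb0], ?_⟩
    rw [hsum, h2]; exact tsub_add_cancel_of_le hba
  rw [← Finset.sum_subset hsub, Finset.sum_image (fun a _ b _ h => add_right_cancel h)]
  · apply Finset.sum_congr rfl
    intro φ hφ
    rw [dtm_add _ _ _ hβ, tm_subset w (FS_support hφ), tm_subset w (L := lowerMulti α)]
    intro γ hγ
    have := mem_lowerMulti.1 (FS_support hφ hγ)
    exact mem_lowerMulti.2 ⟨this.1, this.2.trans (fun i => Nat.sub_le _ _)⟩
  · intro φ hφ hn
    have : φ β = 0 := by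
      by_contra h0
      apply hn
      have hle : Finsupp.single β 1 ≤ φ := by
        rw [Finsupp.single_le_iff]; omega
      have he : φ - Finsupp.single β 1 + Finsupp.single β 1 = φ := tsub_add_cancel_of_le hle
      refine Finset.mem_image.2 ⟨φ - Finsupp.single β 1, ?_, he⟩
      obtain ⟨h1, h2⟩ := mem_FS.1 hφ
      refine mem_FS.2 ⟨by simp [h1], ?_⟩
      have := hsum (φ - Finsupp.single β 1)
      rw [he, h2] at this
      rw [this, add_tsub_cancel_right]
    simp [dtm, this]

lemma SS_rec (w : (ι → ℕ) → ℝ) (α : ι → ℕ) (j : ι) :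
    (α j : ℝ) * SS w α = ∑ β ∈ lowerMulti α, (β j : ℝ) * w β * SS w (α - β) := by
  have h1 : ∀ β ∈ lowerMulti α, (β j : ℝ) * w β * SS w (α - β) =
      ∑ φ ∈ FS α, (φ β : ℝ) * β j * tm w (lowerMulti α) φ := by
    intro β hβ
    rw [← sum_dtm w hβ, Finset.mul_sum]
    apply Finset.sum_congr rfl
    intro φ _
    rw [mul_assoc, dtm_mul _ _ _ hβ]; ring
  rw [Finset.sum_congr rfl h1, Finset.sum_comm, SS, Finset.mul_sum]
  apply Finset.sum_congr rfl
  intro φ hφ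
  rw [← Finset.sum_mul]
  congr 1
  obtain ⟨_, h2⟩ := mem_FS.1 hφ
  rw [Finsupp.sum_of_support_subset _ (FS_support hφ) _ (by simp)] at h2
  conv_lhs => rw [← h2]
  simp

lemma SS_rec_succ (w : (ι → ℕ) → ℝ) (α : ι → ℕ) (j : ι) :
    ((α j : ℝ) + 1) * SS w (α + Pi.single j 1) =
      w (Pi.single j 1) * SS w α +
      ∑ β ∈ lowerMulti α, ((β j : ℝ) + 1) * w (β + Pi.single j 1) * SS w (α - β) := by
  have h := SS_rec w (α + Pi.single j 1) j
  simp only [Pi.add_apply, Pi.single_eq_same, Nat.cast_add, Nat.cast_one] at h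
  rw [h]
  have h2 : w (Pi.single j 1) * SS w α +
      ∑ β ∈ lowerMulti α, ((β j : ℝ) + 1) * w (β + Pi.single j 1) * SS w (α - β) =
      ∑ β ∈ Finset.Iic α, ((β j : ℝ) + 1) * w (β + Pi.single j 1) * SS w (α - β) := by
    rw [← Finset.add_sum_erase (Finset.Iic α) _ (a := 0) (by simp), lowerMulti]
    simp
  rw [h2]
  symm
  have hsub : (Finset.Iic α).image (fun β => β + Pi.single j 1) ⊆
      lowerMulti (α + Pi.single j 1) := by
    intro γ hγ
    obtain ⟨β, hβ, rfl⟩ := Finset.mem_image.1 hγ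
    refine mem_lowerMulti.2 ⟨?_, ?_⟩
    · intro h0
      have := congrFun h0 j
      simp at this
    · have := Finset.mem_Iic.1 hβ
      exact add_le_add_left this _
  rw [← Finset.sum_subset hsub, Finset.sum_image (fun a _ b _ h => add_right_cancel h)]
  · apply Finset.sum_congr rfl
    intro β _
    have : α + Pi.single j 1 - (β + Pi.single j 1) = α - β := by
      funext i; exact Nat.add_sub_add_right _ _ _
    rw [this]; simp
  · intro γ hγ hn
    have : γ j = 0 := by
      by_contra h0
      apply hn
      have hle : Pi.single j 1 ≤ γ := by
        intro i
        by_cases hi : i = j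
        · subst hi; simp; omega
        · simp [hi]
      refine Finset.mem_image.2 ⟨γ - Pi.single j 1, ?_, tsub_add_cancel_of_le hle⟩
      rw [Finset.mem_Iic]
      exact tsub_le_iff_right.2 (mem_lowerMulti.1 hγ).2
    simp [this]

lemma SS_deriv {w : ℝ → (ι → ℕ) → ℝ} {w' : (ι → ℕ) → ℝ} {s : ℝ} (α : ι → ℕ)
    (h : ∀ β, HasDerivAt (fun t => w t β) (w' β) s) :
    HasDerivAt (fun t => SS (w t) α)
      (∑ β ∈ lowerMulti α, w' β * SS (w s) (α - β)) s := by
  have h1 : ∑ β ∈ lowerMulti α, w' β * SS (w s) (α - β) =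
      ∑ φ ∈ FS α, ∑ β ∈ lowerMulti α, w' β * dtm (w s) (lowerMulti α) φ β := by
    rw [Finset.sum_comm]
    apply Finset.sum_congr rfl
    intro β hβ
    rw [← sum_dtm (w s) hβ, Finset.mul_sum]
  rw [h1]
  unfold SS
  apply HasDerivAt.fun_sum
  intro φ _
  unfold tm
  have := HasDerivAt.fun_finsetProd (u := lowerMulti α)
    (f := fun β t => (1 / ((φ β).factorial : ℝ)) * (w t β) ^ (φ β))
    (f' := fun β => (1 / ((φ β).factorial : ℝ)) * (φ β * (w s β) ^ (φ β - 1) * w' β)) (x := s)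
    (fun β _ => ((h β).fun_pow (φ β)).const_mul _)
  refine this.congr_deriv ?_
  apply Finset.sum_congr rfl
  intro β _
  simp only [dtm, smul_eq_mul]; ring

lemma SS_zero (w : (ι → ℕ) → ℝ) : SS w 0 = 1 := by
  have hL : lowerMulti (0 : ι → ℕ) = ∅ := by
    ext β
    simp only [mem_lowerMulti, Finset.notMem_empty, iff_false, not_and]
    intro h h2
    exact h (le_antisymm h2 (fun i => Nat.zero_le _))
  have hF : FS (0 : ι → ℕ) = {0} := by
    ext φ
    rw [Finset.mem_singleton]
    constructor
    · intro h
      have := FS_support h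
      rw [hL, Finset.subset_empty, Finsupp.support_eq_empty] at this
      exact this
    · rintro rfl; exact mem_FS.2 (by simp)
  simp [SS, hF, hL, tm]

lemma hasDerivAt_pd {f : (ι → ℝ) → ℝ} (hf : Differentiable ℝ f) (j : ι) (x : ι → ℝ) :
    HasDerivAt (fun s : ℝ => f (Function.update x j s)) (fderiv ℝ f x (Pi.single j 1)) (x j) := by
  have h1 := hasDerivAt_update x j (x j)
  have h2 : HasFDerivAt f (fderiv ℝ f x) (Function.update x j (x j)) := by
    rw [Function.update_eq_self]; exact (hf x).hasFDerivAt
  exact h2.comp_hasDerivAt (x j) h1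

lemma pd_eq {f : (ι → ℝ) → ℝ} (hf : ContDiff ℝ (⊤ : ℕ∞) f) (j : ι) :
    pd j f = fun x => fderiv ℝ f x (Pi.single j 1) := by
  funext x
  exact (hasDerivAt_pd (hf.differentiable (by simp)) j x).deriv

lemma pd_smooth {f : (ι → ℝ) → ℝ} (hf : ContDiff ℝ (⊤ : ℕ∞) f) (j : ι) :
    ContDiff ℝ (⊤ : ℕ∞) (pd j f) := by
  rw [pd_eq hf]
  exact (hf.fderiv_right (m := ((⊤ : ℕ∞) : WithTop ℕ∞)) (by simp)).clm_apply contDiff_const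

lemma pd_comm {f : (ι → ℝ) → ℝ} (hf : ContDiff ℝ (⊤ : ℕ∞) f) (i j : ι) :
    pd i (pd j f) = pd j (pd i f) := by
  rw [pd_eq (pd_smooth hf j), pd_eq (pd_smooth hf i), pd_eq hf, pd_eq hf]
  funext x
  have hd : Differentiable ℝ (fderiv ℝ f) :=
    (hf.fderiv_right (m := ((⊤ : ℕ∞) : WithTop ℕ∞)) (by simp)).differentiable (by simp)
  have hs : IsSymmSndFDerivAt ℝ f x := hf.contDiffAt.isSymmSndFDerivAt (by
    simp only [minSmoothness_of_isRCLikeNormedField]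
    exact WithTop.coe_le_coe.2 (le_top : (2 : ℕ∞) ≤ ⊤))
  rw [fderiv_clm_apply (hd x) (differentiableAt_const _),
    fderiv_clm_apply (hd x) (differentiableAt_const _)]
  simpa using hs.eq _ _

lemma pd_iter_smooth {f : (ι → ℝ) → ℝ} (hf : ContDiff ℝ (⊤ : ℕ∞) f) (j : ι) (k : ℕ) :
    ContDiff ℝ (⊤ : ℕ∞) ((pd j)^[k] f) := by
  induction k with
  | zero => exact hf
  | succ k ih => rw [Function.iterate_succ_apply']; exact pd_smooth ih j

lemma pd_iter_comm {f : (ι → ℝ) → ℝ} (hf : ContDiff ℝ (⊤ : ℕ∞) f) (i j : ι) (k : ℕ) :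
    (pd j)^[k] (pd i f) = pd i ((pd j)^[k] f) := by
  induction k with
  | zero => rfl
  | succ k ih =>
    rw [Function.iterate_succ_apply', Function.iterate_succ_apply', ih,
      pd_comm (pd_iter_smooth hf j k)]

lemma foldr_smooth {f : (ι → ℝ) → ℝ} (hf : ContDiff ℝ (⊤ : ℕ∞) f) (β : ι → ℕ) (l : List ι) :
    ContDiff ℝ (⊤ : ℕ∞) (l.foldr (fun j g => (pd j)^[β j] g) f) := by
  induction l with
  | nil => exact hf
  | cons a l ih => exact pd_iter_smooth ih a _

lemma foldr_notMem (f : (ι → ℝ) → ℝ) (β : ι → ℕ) (j : ι) (l : List ι) (hj : j ∉ l) :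
    l.foldr (fun i g => (pd i)^[(β + Pi.single j 1 : ι → ℕ) i] g) f =
      l.foldr (fun i g => (pd i)^[β i] g) f := by
  induction l with
  | nil => rfl
  | cons a l ih =>
    simp only [List.mem_cons, not_or] at hj
    simp only [List.foldr_cons]
    rw [ih hj.2]
    have : (β + Pi.single j 1 : ι → ℕ) a = β a := by simp [Ne.symm hj.1]
    rw [this]

lemma foldr_succ {f : (ι → ℝ) → ℝ} (hf : ContDiff ℝ (⊤ : ℕ∞) f) (β : ι → ℕ) (j : ι)
    (l : List ι) (hl : l.Nodup) (hj : j ∈ l) :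
    l.foldr (fun i g => (pd i)^[(β + Pi.single j 1 : ι → ℕ) i] g) f =
      pd j (l.foldr (fun i g => (pd i)^[β i] g) f) := by
  induction l with
  | nil => simp at hj
  | cons a l ih =>
    rw [List.nodup_cons] at hl
    simp only [List.foldr_cons]
    by_cases h : a = j
    · subst h
      rw [foldr_notMem _ _ _ _ hl.1]
      have : (β + Pi.single a 1 : ι → ℕ) a = β a + 1 := by simp
      rw [this, Function.iterate_succ_apply']
    · have hj' : j ∈ l := by
        rcases List.mem_cons.1 hj with h' | h'
        · exact absurd h'.symm h
        · exact h'
      rw [ih hl.2 hj']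
      have : (β + Pi.single j 1 : ι → ℕ) a = β a := by simp [h]
      rw [this, pd_iter_comm (foldr_smooth hf β l)]

lemma mderiv_succ {f : (ι → ℝ) → ℝ} (hf : ContDiff ℝ (⊤ : ℕ∞) f) (β : ι → ℕ) (j : ι) :
    mderiv (β + Pi.single j 1) f = pd j (mderiv β f) :=
  foldr_succ hf β j _ (Finset.nodup_toList _) (by simp)

lemma mderiv_smooth {f : (ι → ℝ) → ℝ} (hf : ContDiff ℝ (⊤ : ℕ∞) f) (β : ι → ℕ) :
    ContDiff ℝ (⊤ : ℕ∞) (mderiv β f) := foldr_smooth hf β _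

lemma mderiv_zero (f : (ι → ℝ) → ℝ) : mderiv 0 f = f := by
  unfold mderiv
  induction (Finset.univ : Finset ι).toList with
  | nil => rfl
  | cons a l ih => simp

lemma mfact_succ (β : ι → ℕ) (j : ι) : mfact (β + Pi.single j 1) = (β j + 1) * mfact β := by
  unfold mfact
  rw [← Finset.mul_prod_erase _ _ (Finset.mem_univ j),
    ← Finset.mul_prod_erase _ (fun i => (β i).factorial) (Finset.mem_univ j)]
  have : ∀ i ∈ Finset.univ.erase j, ((β + Pi.single j 1 : ι → ℕ) i).factorial = (β i).factorial := by
    intro i hi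
    simp [Finset.ne_of_mem_erase hi]
  rw [Finset.prod_congr rfl this]
  simp [Nat.factorial_succ, mul_assoc]

lemma mfact_ne (β : ι → ℕ) : (mfact β : ℝ) ≠ 0 := by
  unfold mfact
  exact_mod_cast Finset.prod_ne_zero_iff.2 (fun i _ => Nat.factorial_ne_zero _)

/-- Taylor coefficient -/
noncomputable def tc (W : (ι → ℝ) → ℝ) (x : ι → ℝ) (β : ι → ℕ) : ℝ := mderiv β W x / mfact β

lemma tc_deriv {W : (ι → ℝ) → ℝ} (hW : ContDiff ℝ (⊤ : ℕ∞) W) (x : ι → ℝ) (β : ι → ℕ) (j : ι) :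
    HasDerivAt (fun s => tc W (Function.update x j s) β)
      (((β j : ℝ) + 1) * tc W x (β + Pi.single j 1)) (x j) := by
  have hs := mderiv_smooth hW β
  have h := (hasDerivAt_pd (hs.differentiable (by simp)) j x).div_const (mfact β : ℝ)
  refine h.congr_deriv ?_
  rw [tc, mderiv_succ hW, pd_eq hs, mfact_succ]
  have := mfact_ne β
  have h2 : ((β j : ℝ) + 1) ≠ 0 := by positivity
  push_cast
  field_simp

lemma multi_induction {P : (ι → ℕ) → Prop} (h0 : P 0)
    (hs : ∀ α j, P α → P (α + Pi.single j 1)) (α : ι → ℕ) : P α := by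
  obtain ⟨m, hm⟩ : ∃ m, ∑ i, α i = m := ⟨_, rfl⟩
  induction m generalizing α with
  | zero =>
    have : α = 0 := by
      funext i
      exact (Finset.sum_eq_zero_iff.1 hm) i (Finset.mem_univ i)
    rw [this]; exact h0
  | succ m ih =>
    have : ∃ j, α j ≠ 0 := by
      by_contra hc
      push Not at hc
      simp [hc] at hm
    obtain ⟨j, hj⟩ := this
    have hle : Pi.single j 1 ≤ α := by
      intro i
      by_cases hi : i = j
      · subst hi; simp; omega
      · simp [hi]
    have he : α - Pi.single j 1 + Pi.single j 1 = α := tsub_add_cancel_of_le hle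
    rw [← he]
    apply hs
    apply ih
    rw [← he] at hm
    simp only [Pi.add_apply, Finset.sum_add_distrib] at hm
    have h1 : ∑ i, (Pi.single j 1 : ι → ℕ) i = 1 := by simp
    omega

lemma main_aux {W : (ι → ℝ) → ℝ} (hW : ContDiff ℝ (⊤ : ℕ∞) W) (α : ι → ℕ) :
    mderiv α (fun y => Real.exp (W y)) =
      fun x => (mfact α : ℝ) * Real.exp (W x) * SS (tc W x) α := by
  have hE : ContDiff ℝ (⊤ : ℕ∞) (fun y => Real.exp (W y)) := hW.exp
  induction α using multi_induction with
  | h0 => rw [mderiv_zero]; funext x; simp [SS_zero, mfact]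
  | hs α j ih =>
    rw [mderiv_succ hE, ih]
    funext x
    have hw0 : HasDerivAt (fun s => W (Function.update x j s)) (tc W x (Pi.single j 1)) (x j) := by
      have := tc_deriv hW x 0 j
      simpa [tc, mderiv_zero, mfact] using this
    have hS := SS_deriv (w := fun s => tc W (Function.update x j s)) α (fun β => tc_deriv hW x β j)
    have h := ((hw0.exp.const_mul (mfact α : ℝ)).mul hS).deriv
    simp only [Function.update_eq_self] at h
    refine Eq.trans h ?_
    rw [mfact_succ]
    push_cast
    have := SS_rec_succ (tc W x) α j
    linear_combination -((mfact α : ℝ) * Real.exp (W x)) * this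

lemma SS_eq_tsum (w : (ι → ℕ) → ℝ) (α : ι → ℕ) :
    ∑' φ : FaaF α, ∏ β ∈ lowerMulti α, (1 / ((φ.1 β).factorial : ℝ)) * (w β) ^ (φ.1 β) =
      SS w α := by
  have h0 : (0 : ι → ℕ) ∉ lowerMulti α := by simp [lowerMulti]
  let e : FaaF α ≃ {φ // φ ∈ FS α} :=
    { toFun := fun φ => ⟨Finsupp.onFinset (lowerMulti α) φ.1
        (fun β hβ => by by_contra h; exact hβ (φ.2.1 β h)), by
          refine mem_FS.2 ⟨φ.2.1 0 h0, ?_⟩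
          rw [Finsupp.sum_of_support_subset _ Finsupp.support_onFinset_subset _ (by simp)]
          exact φ.2.2⟩
      invFun := fun φ => ⟨φ.1, fun β hβ => by
          by_contra h
          exact hβ (FS_support φ.2 (Finsupp.mem_support_iff.2 h)), by
          have := (mem_FS.1 φ.2).2
          rwa [Finsupp.sum_of_support_subset _ (FS_support φ.2) _ (by simp)] at this⟩
      left_inv := fun φ => rfl
      right_inv := fun φ => by ext; rfl }
  have := e.tsum_eq (fun φ => tm w (lowerMulti α) φ.1)
  rw [SS, ← Finset.tsum_subtype]
  exact this

end helpers

/-- (Multivariate Faà di Bruno formula for the exponential, after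
Constantine–Savits.) For `W : ℝⁿ → ℝ` smooth and `α ≠ 0`,
`∂^α(e^W)(x) = α! e^{W(x)} ∑_{φ ∈ F(α)} ∏_{0≠β≤α} (1/φ(β)!) (∂^β W(x)/β!)^{φ(β)}`. -/
theorem faa_di_bruno_exp
    (n : ℕ) (W : (Fin n → ℝ) → ℝ) (hW : ContDiff ℝ (⊤ : ℕ∞) W)
    (α : Fin n → ℕ) (hα : α ≠ 0) (x : Fin n → ℝ) :
    mderiv α (fun y => Real.exp (W y)) x =
      (mfact α : ℝ) * Real.exp (W x) *
        ∑' φ : FaaF α, ∏ β ∈ lowerMulti α,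
          (1 / ((φ.1 β).factorial : ℝ)) * (mderiv β W x / (mfact β : ℝ)) ^ (φ.1 β) := by
  rw [main_aux hW α]
  beta_reduce
  rw [← SS_eq_tsum]
  rfl
end

section
/- Let α ∈ ℕⁿ be a nonzero multi-index and let c_β ≥ 0 be given real numbers for each nonzero multi-index β ≤ α. Then Σ_{φ ∈ F(α)} Π_{0 ≠ β ≤ α} c_β^{φ(β)} / φ(β)! ≤ exp( Σ_{0 ≠ β ≤ α} c_β ). -/
open MeasureTheory ProbabilityTheory

/-- For a nonzero multi-index `α` and nonnegative reals `c_β` indexed by the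
nonzero multi-indices `β ≤ α`,
`∑_{φ ∈ F(α)} ∏_{0≠β≤α} c_β^{φ(β)}/φ(β)! ≤ exp(∑_{0≠β≤α} c_β)`. -/
theorem faa_sum_le_exp
    (n : ℕ) (α : Fin n → ℕ) (hα : α ≠ 0) (c : (Fin n → ℕ) → ℝ)
    (hc : ∀ β ∈ lowerMulti α, 0 ≤ c β) :
    (∑' φ : FaaF α, ∏ β ∈ lowerMulti α, c β ^ (φ.1 β) / ((φ.1 β).factorial : ℝ)) ≤
      Real.exp (∑ β ∈ lowerMulti α, c β) := by
  classical
  refine tsum_le_of_sum_le' (Real.exp_nonneg _) fun s => ?_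
  set L := lowerMulti α with hL
  set N : ℕ := s.sup (fun φ => L.sup φ.1) + 1 with hN
  have hlt : ∀ φ ∈ s, ∀ β ∈ L, φ.1 β < N := by
    intro φ hφ β hβ
    have h1 : φ.1 β ≤ L.sup φ.1 := Finset.le_sup (f := φ.1) hβ
    have h2 : L.sup φ.1 ≤ s.sup (fun φ => L.sup φ.1) :=
      Finset.le_sup (f := fun φ : FaaF α => L.sup φ.1) hφ
    omega
  have hpos : ∀ β ∈ L, ∀ k : ℕ, 0 ≤ c β ^ k / (k.factorial : ℝ) := fun β hβ k =>
    div_nonneg (pow_nonneg (hc β hβ) _) (Nat.cast_nonneg _)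
  let e : FaaF α → ((β : Fin n → ℕ) → β ∈ L → ℕ) := fun φ β _ => φ.1 β
  have hinj : Function.Injective e := by
    intro φ ψ h
    apply Subtype.ext
    funext β
    by_cases hβ : β ∈ L
    · exact congrFun (congrFun h β) hβ
    · rw [φ.2.1 β hβ, ψ.2.1 β hβ]
  calc ∑ φ ∈ s, ∏ β ∈ L, c β ^ (φ.1 β) / ((φ.1 β).factorial : ℝ)
      = ∑ p ∈ s.image e, ∏ x ∈ L.attach,
          c x.1 ^ (p x.1 x.2) / ((p x.1 x.2).factorial : ℝ) := by
        rw [Finset.sum_image (fun a _ b _ h => hinj h)]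
        refine Finset.sum_congr rfl fun φ _ => ?_
        exact (Finset.prod_attach L
          (fun β => c β ^ (φ.1 β) / ((φ.1 β).factorial : ℝ))).symm
    _ ≤ ∑ p ∈ L.pi (fun _ => Finset.range N), ∏ x ∈ L.attach,
          c x.1 ^ (p x.1 x.2) / ((p x.1 x.2).factorial : ℝ) := by
        refine Finset.sum_le_sum_of_subset_of_nonneg ?_ ?_
        · intro p hp
          obtain ⟨φ, hφ, rfl⟩ := Finset.mem_image.1 hp
          exact Finset.mem_pi.2 fun β hβ => Finset.mem_range.2 (hlt φ hφ β hβ)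
        · intro p _ _
          exact Finset.prod_nonneg fun x _ => hpos x.1 x.2 _
    _ = ∏ β ∈ L, ∑ k ∈ Finset.range N, c β ^ k / (k.factorial : ℝ) := by
        rw [Finset.prod_sum]
    _ ≤ ∏ β ∈ L, Real.exp (c β) :=
        Finset.prod_le_prod (fun β hβ => Finset.sum_nonneg fun k _ => hpos β hβ k)
          (fun β hβ => Real.sum_le_exp_of_nonneg (hc β hβ) N)
    _ = Real.exp (∑ β ∈ L, c β) := (Real.exp_sum _ _).symm
end

section
/- (Nearest neighbor interaction.) Let d ≥ 1 and let F, G : ℝ → [0,∞) be C^∞ functions that are bounded together with all their derivatives. For each finite subset Λ of ℤ^d define V_Λ : ℝ^Λ → [0,∞) by V_Λ(x) = Σ_{j ∈ Λ} F(x_j) + Σ_{(j,k) ∈ Λ², |j−k|_∞ = 1} G(x_j − x_k). Then for every integer m ≥ 1 there exists a constant C_m > 0, independent of Λ, such that for every finite subset Λ of ℤ^d, every multi-index α ∈ ℕ^Λ with α_j ≤ m for all j ∈ Λ, and every x ∈ ℝ^Λ, Σ_{0 ≠ β ≤ α} |∂^β V_Λ(x)| ≤ C_m |S(α)|. -/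
open MeasureTheory ProbabilityTheory

lemma pd_term {ι T : Type*} [Fintype ι] [DecidableEq ι] (s : Finset T) (φ : T → ℝ → ℝ)
    (hφ : ∀ t, ContDiff ℝ (⊤ : ℕ∞) (φ t)) (l : T → ((ι → ℝ) →L[ℝ] ℝ)) (a : T → ℝ) (k : ℕ)
    (j : ι) :
    pd j (fun x => ∑ t ∈ s, a t * iteratedDeriv k (φ t) (l t x)) =
      fun x => ∑ t ∈ s, (l t (Pi.single j 1) * a t) * iteratedDeriv (k + 1) (φ t) (l t x) := by
  funext x
  unfold pd
  apply HasDerivAt.deriv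
  apply HasDerivAt.fun_sum
  intro t _
  have h1 : HasDerivAt (fun r : ℝ => l t (Function.update x j r)) (l t (Pi.single j 1)) (x j) :=
    (l t).hasFDerivAt.comp_hasDerivAt (x j) (hasDerivAt_update x j (x j))
  have h2 : HasDerivAt (iteratedDeriv k (φ t)) (iteratedDeriv (k + 1) (φ t) (l t x))
      (l t (Function.update x j (x j))) := by
    rw [Function.update_eq_self, iteratedDeriv_succ]
    apply DifferentiableAt.hasDerivAt
    exact (hφ t).differentiable_iteratedDeriv k (by exact_mod_cast WithTop.coe_lt_top k) _
  have h3 := (h2.comp (x j) h1).const_mul (a t)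
  refine HasDerivAt.congr_deriv (f' := a t * (iteratedDeriv (k + 1) (φ t) (l t x) * l t (Pi.single j 1))) h3 ?_
  ring

lemma pd_iter {ι T : Type*} [Fintype ι] [DecidableEq ι] (s : Finset T) (φ : T → ℝ → ℝ)
    (hφ : ∀ t, ContDiff ℝ (⊤ : ℕ∞) (φ t)) (l : T → ((ι → ℝ) →L[ℝ] ℝ)) (a : T → ℝ) (k : ℕ)
    (j : ι) (n : ℕ) :
    (pd j)^[n] (fun x => ∑ t ∈ s, a t * iteratedDeriv k (φ t) (l t x)) =
      fun x => ∑ t ∈ s, (l t (Pi.single j 1) ^ n * a t) *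
        iteratedDeriv (n + k) (φ t) (l t x) := by
  induction n with
  | zero => simp
  | succ n ih =>
    rw [Function.iterate_succ_apply', ih, pd_term s φ hφ]
    funext x
    refine Finset.sum_congr rfl fun t _ => ?_
    rw [show n + k + 1 = n + 1 + k by omega]
    ring

lemma mderiv_formula {ι T : Type*} [Fintype ι] [DecidableEq ι] (s : Finset T) (φ : T → ℝ → ℝ)
    (hφ : ∀ t, ContDiff ℝ (⊤ : ℕ∞) (φ t)) (l : T → ((ι → ℝ) →L[ℝ] ℝ)) (β : ι → ℕ) :
    mderiv β (fun x => ∑ t ∈ s, φ t (l t x)) =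
      fun x => ∑ t ∈ s, (∏ j, l t (Pi.single j 1) ^ β j) *
        iteratedDeriv (∑ j, β j) (φ t) (l t x) := by
  have key : ∀ L : List ι, L.foldr (fun j g => (pd j)^[β j] g)
      (fun x => ∑ t ∈ s, φ t (l t x)) =
      fun x => ∑ t ∈ s, (L.map fun j => l t (Pi.single j 1) ^ β j).prod *
        iteratedDeriv (L.map β).sum (φ t) (l t x) := by
    intro L
    induction L with
    | nil => simp
    | cons j L ih =>
      rw [List.foldr_cons, ih, pd_iter s φ hφ l]
      simp
  unfold mderiv
  rw [key]
  simp only [Finset.prod_map_toList, Finset.sum_map_toList]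

lemma term_bound {ι : Type*} [Fintype ι] [DecidableEq ι] (α : ι → ℕ) (m : ℕ)
    (hα : ∀ i, α i ≤ m) (c : ι → ℝ) (j k : ι) (hc : ∀ i, |c i| ≤ 1)
    (hc0 : ∀ i, i ≠ j → i ≠ k → c i = 0) (h : ℕ → ℝ) (M : ℝ) (hM : 0 ≤ M)
    (hh : ∀ n ≤ 2 * m, |h n| ≤ M) :
    ∑ β ∈ lowerMulti α, |(∏ i, c i ^ β i) * h (∑ i, β i)| ≤
      ((m + 1 : ℝ) ^ 2 * M) * ((if α j ≠ 0 then 1 else 0) + (if α k ≠ 0 then 1 else 0)) := by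
  classical
  set B' := (lowerMulti α).filter (fun β => ∀ i, i ≠ j → i ≠ k → β i = 0) with hB
  have h1 : ∑ β ∈ lowerMulti α, |(∏ i, c i ^ β i) * h (∑ i, β i)| ≤ ∑ β ∈ B', M := by
    rw [hB, Finset.sum_filter]
    apply Finset.sum_le_sum
    intro β hβ
    have hβα : β ≤ α := by
      simp only [lowerMulti, Finset.mem_erase, Finset.mem_Iic] at hβ
      exact hβ.2
    split_ifs with hs
    · rw [abs_mul, Finset.abs_prod]
      have e1 : ∏ i, |c i ^ β i| ≤ 1 := by
        apply Finset.prod_le_one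
        · intros; positivity
        · intro i _
          rw [abs_pow]
          exact pow_le_one₀ (abs_nonneg _) (hc i)
      have e2 : ∑ i, β i ≤ 2 * m := by
        have : ∑ i, β i = ∑ i ∈ ({j, k} : Finset ι), β i := by
          symm
          apply Finset.sum_subset (Finset.subset_univ _)
          intro i _ hi
          simp only [Finset.mem_insert, Finset.mem_singleton, not_or] at hi
          exact hs i hi.1 hi.2
        rw [this]
        refine (Finset.sum_le_card_nsmul _ _ m fun i _ => (hβα i).trans (hα i)).trans ?_
        rw [smul_eq_mul]
        exact Nat.mul_le_mul_right _ Finset.card_le_two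
      calc _ ≤ 1 * M := mul_le_mul e1 (hh _ e2) (abs_nonneg _) zero_le_one
        _ = M := one_mul M
    · push Not at hs
      obtain ⟨i, hij, hik, hi⟩ := hs
      have : ∏ i, c i ^ β i = 0 := by
        apply Finset.prod_eq_zero (Finset.mem_univ i)
        rw [hc0 i hij hik, zero_pow hi]
      rw [this]; simp
  refine h1.trans ?_
  rw [Finset.sum_const, nsmul_eq_mul]
  have hcard : B'.card ≤ (m + 1) ^ 2 := by
    have : B'.card ≤ (Finset.range (m + 1) ×ˢ Finset.range (m + 1)).card := by
      apply Finset.card_le_card_of_injOn (fun β => (β j, β k))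
      · intro β hβ
        simp only [hB, lowerMulti, Finset.coe_filter, Finset.mem_erase, Finset.mem_Iic,
          Set.mem_ofPred_eq] at hβ
        have a1 : β j ≤ m := (hβ.1.2 j).trans (hα j)
        have a2 : β k ≤ m := (hβ.1.2 k).trans (hα k)
        simp only [Finset.coe_product, Set.mem_prod, Finset.mem_coe, Finset.mem_range]
        omega
      · intro β hβ γ hγ hbg
        simp only [hB, Finset.coe_filter, Set.mem_ofPred_eq] at hβ hγ
        simp only [Prod.mk.injEq] at hbg
        funext i
        by_cases h1 : i = j
        · rw [h1]; exact hbg.1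
        by_cases h2 : i = k
        · rw [h2]; exact hbg.2
        rw [hβ.2 i h1 h2, hγ.2 i h1 h2]
    rw [Finset.card_product, Finset.card_range] at this
    rw [sq]; exact this
  by_cases h0 : α j = 0 ∧ α k = 0
  · have : B' = ∅ := by
      rw [Finset.eq_empty_iff_forall_notMem]
      intro β hβ
      simp only [hB, lowerMulti, Finset.mem_filter, Finset.mem_erase, Finset.mem_Iic] at hβ
      apply hβ.1.1
      funext i
      by_cases h1 : i = j
      · have h3 : β j ≤ α j := hβ.1.2 j
        rw [h1, Pi.zero_apply]; omega
      by_cases h2 : i = k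
      · have h3 : β k ≤ α k := hβ.1.2 k
        rw [h2, Pi.zero_apply]; omega
      exact hβ.2 i h1 h2
    rw [this]; simp [h0.1, h0.2]
  · have e1 : (1 : ℝ) ≤ (if α j ≠ 0 then 1 else 0) + (if α k ≠ 0 then 1 else 0) := by
      split_ifs <;> first | (exfalso; tauto) | norm_num
    have e2 : (B'.card : ℝ) * M ≤ (m + 1 : ℝ) ^ 2 * M := by
      gcongr
      exact_mod_cast hcard
    calc _ ≤ (m + 1 : ℝ) ^ 2 * M * 1 := by rw [mul_one]; exact e2
      _ ≤ _ := by gcongr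

lemma nbr_card (d : ℕ) (Λ : Finset (Fin d → ℤ)) (j : ↥Λ) (s : Finset ↥Λ)
    (hs : ∀ k ∈ s, ∀ i, ((j : Fin d → ℤ) i - (k : Fin d → ℤ) i).natAbs ≤ 1) :
    s.card ≤ 3 ^ d := by
  have : s.card ≤ (Fintype.piFinset (fun _ : Fin d => Finset.Icc (-1 : ℤ) 1)).card := by
    apply Finset.card_le_card_of_injOn (fun k : ↥Λ => fun i => (j : Fin d → ℤ) i - (k : Fin d → ℤ) i)
    · intro k hk
      simp only [Finset.mem_coe, Fintype.mem_piFinset, Finset.mem_Icc]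
      intro i
      have := hs k hk i
      omega
    · intro k _ k' _ h
      apply Subtype.ext
      funext i
      have := congrFun h i
      simp only at this
      omega
  simpa [Fintype.card_piFinset] using this

lemma sum_ind {ι : Type*} [Fintype ι] (α : ι → ℕ) :
    ∑ j, (if α j ≠ 0 then (1 : ℝ) else 0) = suppCard α := by
  unfold suppCard
  rw [Finset.sum_boole]

lemma pair_sum {ι : Type*} [Fintype ι] [DecidableEq ι] (α : ι → ℕ) (R : ι × ι → Prop)
    [DecidablePred R] (N : ℕ) (h1 : ∀ j, (Finset.univ.filter fun k => R (j, k)).card ≤ N)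
    (h2 : ∀ k, (Finset.univ.filter fun j => R (j, k)).card ≤ N) :
    ∑ p ∈ Finset.univ.filter R,
      ((if α p.1 ≠ 0 then (1 : ℝ) else 0) + (if α p.2 ≠ 0 then 1 else 0)) ≤
      2 * N * suppCard α := by
  rw [Finset.sum_add_distrib]
  have a1 : ∑ p ∈ Finset.univ.filter R, (if α p.1 ≠ 0 then (1 : ℝ) else 0) ≤ N * suppCard α := by
    rw [Finset.sum_filter, Fintype.sum_prod_type, ← sum_ind, Finset.mul_sum]
    apply Finset.sum_le_sum
    intro j _
    rw [← Finset.sum_filter]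
    have : ((Finset.univ.filter fun k => R (j, k)).card : ℝ) ≤ N := by exact_mod_cast h1 j
    by_cases hj : α j = 0
    · simp [hj]
    · simpa [hj] using this
  have a2 : ∑ p ∈ Finset.univ.filter R, (if α p.2 ≠ 0 then (1 : ℝ) else 0) ≤ N * suppCard α := by
    rw [Finset.sum_filter, Fintype.sum_prod_type_right, ← sum_ind, Finset.mul_sum]
    apply Finset.sum_le_sum
    intro j _
    rw [← Finset.sum_filter]
    have : ((Finset.univ.filter fun k => R (k, j)).card : ℝ) ≤ N := by exact_mod_cast h2 j
    by_cases hj : α j = 0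
    · simp [hj]
    · simpa [hj] using this
  linarith

/-- (Nearest neighbor interaction.) For `F, G : ℝ → [0,∞)` smooth and bounded
together with all their derivatives, the potentials
`V_Λ(x) = ∑_{j∈Λ} F(x_j) + ∑_{(j,k)∈Λ², |j-k|_∞=1} G(x_j - x_k)` on `ℝ^Λ`, `Λ ⊆ ℤ^d` finite,
satisfy: for every `m ≥ 1` there is `C_m > 0`, independent of `Λ`, with
`∑_{0≠β≤α} |∂^β V_Λ(x)| ≤ C_m |S(α)|` for all `Λ`, all `α ∈ ℕ^Λ` with `α_j ≤ m`, all `x`. -/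
theorem nearest_neighbor_potential_estimate
    (d : ℕ) (hd : 1 ≤ d) (F G : ℝ → ℝ)
    (hFpos : ∀ y, 0 ≤ F y) (hGpos : ∀ y, 0 ≤ G y)
    (hF : ContDiff ℝ (⊤ : ℕ∞) F) (hG : ContDiff ℝ (⊤ : ℕ∞) G)
    (hFbdd : ∀ k : ℕ, ∃ M : ℝ, ∀ y, |iteratedDeriv k F y| ≤ M)
    (hGbdd : ∀ k : ℕ, ∃ M : ℝ, ∀ y, |iteratedDeriv k G y| ≤ M)
    (m : ℕ) (hm : 1 ≤ m) :
    ∃ C : ℝ, 0 < C ∧ ∀ (Λ : Finset (Fin d → ℤ)) (α : ↥Λ → ℕ), (∀ j, α j ≤ m) →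
      ∀ x : ↥Λ → ℝ,
        ∑ β ∈ lowerMulti α,
          |mderiv β
            (fun x : ↥Λ → ℝ => (∑ j : ↥Λ, F (x j)) +
              ∑ p ∈ Finset.univ.filter
                  (fun p : ↥Λ × ↥Λ =>
                    (Finset.univ.sup fun i : Fin d => ((p.1 : Fin d → ℤ) i - (p.2 : Fin d → ℤ) i).natAbs) = 1),
                G (x p.1 - x p.2)) x| ≤ C * (suppCard α : ℝ) := by
  classical
  choose MF hMF using hFbdd
  choose MG hMG using hGbdd
  obtain ⟨M, hMpos, hM⟩ : ∃ M : ℝ, 0 < M ∧ ∀ n ≤ 2 * m, ∀ y,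
      |iteratedDeriv n F y| ≤ M ∧ |iteratedDeriv n G y| ≤ M := by
    have hnn : ∀ n ∈ Finset.range (2 * m + 1), 0 ≤ |MF n| + |MG n| := fun n _ => by positivity
    refine ⟨1 + ∑ n ∈ Finset.range (2 * m + 1), (|MF n| + |MG n|), ?_, ?_⟩
    · have := Finset.sum_nonneg hnn
      linarith
    · intro n hn y
      have h1 := Finset.single_le_sum hnn (Finset.mem_range.2 (Nat.lt_succ_of_le hn))
      have h2 := hMF n y
      have h3 := hMG n y
      have h4 := le_abs_self (MF n)
      have h5 := le_abs_self (MG n)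
      have h6 := abs_nonneg (MF n)
      have h7 := abs_nonneg (MG n)
      constructor <;> linarith
  refine ⟨((m + 1 : ℝ) ^ 2 * M) * (2 + 2 * (3 ^ d : ℕ)), by positivity, ?_⟩
  intro Λ α hα x
  set P := Finset.univ.filter
                  (fun p : ↥Λ × ↥Λ =>
                    (Finset.univ.sup fun i : Fin d => ((p.1 : Fin d → ℤ) i - (p.2 : Fin d → ℤ) i).natAbs) = 1) with hP
  set φ : ↥Λ ⊕ (↥Λ × ↥Λ) → ℝ → ℝ := Sum.elim (fun _ => F) (fun _ => G) with hφ
  set l : ↥Λ ⊕ (↥Λ × ↥Λ) → ((↥Λ → ℝ) →L[ℝ] ℝ) :=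
    Sum.elim (fun j => (ContinuousLinearMap.proj j : (↥Λ → ℝ) →L[ℝ] ℝ))
      (fun p => (ContinuousLinearMap.proj p.1 : (↥Λ → ℝ) →L[ℝ] ℝ) -
        (ContinuousLinearMap.proj p.2 : (↥Λ → ℝ) →L[ℝ] ℝ)) with hl
  have hV : (fun x : ↥Λ → ℝ => (∑ j : ↥Λ, F (x j)) + ∑ p ∈ P, G (x p.1 - x p.2)) =
      fun x => ∑ t ∈ Finset.univ.disjSum P, φ t (l t x) := by
    funext x
    rw [Finset.sum_disjSum]
    simp [hφ, hl]
  have hφs : ∀ t, ContDiff ℝ (⊤ : ℕ∞) (φ t) := by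
    rintro (j | p)
    · exact hF
    · exact hG
  rw [hV]
  simp only [mderiv_formula _ φ hφs l]
  have hF1 : ∀ j : ↥Λ, ∑ β ∈ lowerMulti α, |(∏ i, l (Sum.inl j) (Pi.single i 1) ^ β i) *
      iteratedDeriv (∑ i, β i) (φ (Sum.inl j)) (l (Sum.inl j) x)| ≤
      ((m + 1 : ℝ) ^ 2 * M) * ((if α j ≠ 0 then 1 else 0) + (if α j ≠ 0 then 1 else 0)) := by
    intro j
    refine term_bound α m hα (fun i => l (Sum.inl j) (Pi.single i 1)) j j ?_ ?_
      (fun n => iteratedDeriv n (φ (Sum.inl j)) (l (Sum.inl j) x)) M hMpos.le ?_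
    · intro i
      simp only [hl, Sum.elim_inl, ContinuousLinearMap.proj_apply, Pi.single_apply]
      split_ifs <;> simp
    · intro i h _
      simp [hl, Pi.single_apply, h.symm]
    · intro n hn
      exact (hM n hn _).1
  have hG1 : ∀ p : ↥Λ × ↥Λ, ∑ β ∈ lowerMulti α, |(∏ i, l (Sum.inr p) (Pi.single i 1) ^ β i) *
      iteratedDeriv (∑ i, β i) (φ (Sum.inr p)) (l (Sum.inr p) x)| ≤
      ((m + 1 : ℝ) ^ 2 * M) * ((if α p.1 ≠ 0 then 1 else 0) + (if α p.2 ≠ 0 then 1 else 0)) := by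
    intro p
    refine term_bound α m hα (fun i => l (Sum.inr p) (Pi.single i 1)) p.1 p.2 ?_ ?_
      (fun n => iteratedDeriv n (φ (Sum.inr p)) (l (Sum.inr p) x)) M hMpos.le ?_
    · intro i
      simp only [hl, Sum.elim_inr, ContinuousLinearMap.proj_apply, Pi.single_apply,
        ContinuousLinearMap.sub_apply]
      split_ifs <;> simp
    · intro i h h'
      simp [hl, Pi.single_apply, h.symm, h'.symm]
    · intro n hn
      exact (hM n hn _).2
  have hpair : ∑ p ∈ P, ((if α p.1 ≠ 0 then (1 : ℝ) else 0) + (if α p.2 ≠ 0 then 1 else 0)) ≤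
      2 * (3 ^ d : ℕ) * suppCard α := by
    apply pair_sum
    · intro j
      apply nbr_card d Λ j
      intro k hk i
      simp only [Finset.mem_filter, Finset.mem_univ, true_and] at hk
      rw [← hk]
      exact Finset.le_sup (f := fun i : Fin d =>
        ((j : Fin d → ℤ) i - (k : Fin d → ℤ) i).natAbs) (Finset.mem_univ i)
    · intro j
      apply nbr_card d Λ j
      intro k hk i
      simp only [Finset.mem_filter, Finset.mem_univ, true_and] at hk
      rw [← hk, ← Int.natAbs_neg, neg_sub]
      exact Finset.le_sup (f := fun i : Fin d =>
        ((k : Fin d → ℤ) i - (j : Fin d → ℤ) i).natAbs) (Finset.mem_univ i)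
  calc _ ≤ ∑ β ∈ lowerMulti α, ∑ t ∈ Finset.univ.disjSum P,
        |(∏ i, l t (Pi.single i 1) ^ β i) * iteratedDeriv (∑ i, β i) (φ t) (l t x)| :=
        Finset.sum_le_sum fun β _ => Finset.abs_sum_le_sum_abs _ _
    _ = ∑ t ∈ Finset.univ.disjSum P, ∑ β ∈ lowerMulti α,
        |(∏ i, l t (Pi.single i 1) ^ β i) * iteratedDeriv (∑ i, β i) (φ t) (l t x)| :=
        Finset.sum_comm
    _ ≤ ∑ j : ↥Λ, ((m + 1 : ℝ) ^ 2 * M) *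
          ((if α j ≠ 0 then 1 else 0) + (if α j ≠ 0 then 1 else 0)) +
        ∑ p ∈ P, ((m + 1 : ℝ) ^ 2 * M) *
          ((if α p.1 ≠ 0 then 1 else 0) + (if α p.2 ≠ 0 then 1 else 0)) := by
        rw [Finset.sum_disjSum]
        exact add_le_add (Finset.sum_le_sum fun j _ => hF1 j) (Finset.sum_le_sum fun p _ => hG1 p)
    _ ≤ _ := by
        rw [← Finset.mul_sum, ← Finset.mul_sum, Finset.sum_add_distrib, sum_ind, ← mul_add,
          mul_assoc ((m + 1 : ℝ) ^ 2 * M)]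
        apply mul_le_mul_of_nonneg_left _ (by positivity)
        linarith
end

section
/- (Mean field interaction.) Let G : ℝ → [0,∞) be a C^∞ function that is bounded together with all its derivatives. For each nonempty finite set Λ define V_Λ : ℝ^Λ → [0,∞) by V_Λ(x) = (1/|Λ|) Σ_{(j,k) ∈ Λ²} G(x_j − x_k). Then for every integer m ≥ 1 there exists a constant C_m > 0, independent of Λ, such that for every nonempty finite set Λ, every multi-index α ∈ ℕ^Λ with α_j ≤ m for all j ∈ Λ, and every x ∈ ℝ^Λ, Σ_{0 ≠ β ≤ α} |∂^β V_Λ(x)| ≤ C_m |S(α)|. -/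
open MeasureTheory ProbabilityTheory

/-- Coefficient: derivative of `x p.1 - x p.2` in direction `j`. -/
def eCo {ι : Type*} [DecidableEq ι] (p : ι × ι) (j : ι) : ℝ :=
  (if j = p.1 then 1 else 0) - (if j = p.2 then 1 else 0)

lemma hasDerivAt_upd {ι : Type*} [DecidableEq ι] (x : ι → ℝ) (j a : ι) (s : ℝ) :
    HasDerivAt (fun s : ℝ => Function.update x j s a) (if j = a then 1 else 0) s := by
  by_cases h : j = a
  · subst h
    have : (fun s : ℝ => Function.update x j s j) = id := by funext s; simp
    rw [this, if_pos rfl]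
    exact hasDerivAt_id s
  · have : ∀ s : ℝ, Function.update x j s a = x a := fun s =>
      Function.update_of_ne (Ne.symm h) s x
    simp only [this, h, if_false]
    exact hasDerivAt_const s (x a)

lemma pd_pair {ι : Type*} [Fintype ι] [DecidableEq ι] (G : ℝ → ℝ)
    (hG : ContDiff ℝ (⊤ : ℕ∞) G) (c : ℝ) (w : ι × ι → ℝ) (k : ℕ) (j : ι) :
    pd j (fun x : ι → ℝ => c * ∑ p : ι × ι, w p * iteratedDeriv k G (x p.1 - x p.2)) =
      fun x : ι → ℝ => c * ∑ p : ι × ι,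
        (eCo p j * w p) * iteratedDeriv (k + 1) G (x p.1 - x p.2) := by
  funext x
  unfold pd
  apply HasDerivAt.deriv
  apply HasDerivAt.const_mul
  apply HasDerivAt.fun_sum
  intro p _
  have h1 := (hasDerivAt_upd x j p.1 (x j)).sub (hasDerivAt_upd x j p.2 (x j))
  have hd : Differentiable ℝ (iteratedDeriv k G) :=
    hG.differentiable_iteratedDeriv k (by exact_mod_cast WithTop.coe_lt_top k)
  have h2 : HasDerivAt (iteratedDeriv k G) (iteratedDeriv (k + 1) G (x p.1 - x p.2))
      (Function.update x j (x j) p.1 - Function.update x j (x j) p.2) := by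
    rw [Function.update_eq_self, iteratedDeriv_succ]
    exact (hd _).hasDerivAt
  have h3 := (HasDerivAt.comp (x j) h2 h1).const_mul (w p)
  exact h3.congr_deriv (by unfold eCo; ring)

lemma pd_pair_iter {ι : Type*} [Fintype ι] [DecidableEq ι] (G : ℝ → ℝ)
    (hG : ContDiff ℝ (⊤ : ℕ∞) G) (c : ℝ) (w : ι × ι → ℝ) (k : ℕ) (j : ι) (n : ℕ) :
    (pd j)^[n] (fun x : ι → ℝ => c * ∑ p : ι × ι, w p * iteratedDeriv k G (x p.1 - x p.2)) =
      fun x : ι → ℝ => c * ∑ p : ι × ι,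
        (eCo p j ^ n * w p) * iteratedDeriv (n + k) G (x p.1 - x p.2) := by
  induction n with
  | zero => simp
  | succ n ih =>
    rw [Function.iterate_succ_apply', ih, pd_pair G hG]
    funext x
    congr 1
    refine Finset.sum_congr rfl fun p _ => ?_
    rw [show n + 1 + k = n + k + 1 by ring]
    ring

lemma mderiv_pair {ι : Type*} [Fintype ι] [DecidableEq ι] (G : ℝ → ℝ)
    (hG : ContDiff ℝ (⊤ : ℕ∞) G) (c : ℝ) (β : ι → ℕ) :
    mderiv β (fun x : ι → ℝ => c * ∑ p : ι × ι, G (x p.1 - x p.2)) =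
      fun x : ι → ℝ => c * ∑ p : ι × ι,
        (∏ j, eCo p j ^ β j) * iteratedDeriv (∑ j, β j) G (x p.1 - x p.2) := by
  have key : ∀ l : List ι, l.foldr (fun j g => (pd j)^[β j] g)
      (fun x : ι → ℝ => c * ∑ p : ι × ι, G (x p.1 - x p.2)) =
      fun x : ι → ℝ => c * ∑ p : ι × ι,
        (l.map (fun j => eCo p j ^ β j)).prod *
          iteratedDeriv (l.map β).sum G (x p.1 - x p.2) := by
    intro l
    induction l with
    | nil => simp
    | cons a l ih =>
      rw [List.foldr_cons, ih, pd_pair_iter G hG]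
      simp
  unfold mderiv
  rw [key]
  simp only [Finset.prod_map_toList, Finset.sum_map_toList]

lemma abs_prod_eCo_le {ι : Type*} [Fintype ι] [DecidableEq ι] (p : ι × ι) (β : ι → ℕ) :
    |∏ j, eCo p j ^ β j| ≤ 1 := by
  rw [Finset.abs_prod]
  refine Finset.prod_le_one (fun _ _ => abs_nonneg _) fun j _ => ?_
  rw [abs_pow]
  refine pow_le_one₀ (abs_nonneg _) ?_
  unfold eCo
  split_ifs <;> simp

lemma supp_of_ne {ι : Type*} [Fintype ι] [DecidableEq ι] (p : ι × ι) (β : ι → ℕ)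
    (h : ∏ j, eCo p j ^ β j ≠ 0) (j : ι) (h1 : j ≠ p.1) (h2 : j ≠ p.2) : β j = 0 := by
  by_contra hb
  apply h
  apply Finset.prod_eq_zero (Finset.mem_univ j)
  simp [eCo, h1, h2, hb]

lemma pair_bound {ι : Type*} [Fintype ι] [DecidableEq ι] (g : ℕ → ℝ) (M : ℝ) (hM : 0 ≤ M)
    (m : ℕ) (hg : ∀ k ≤ 2 * m, |g k| ≤ M) (α : ι → ℕ) (hα : ∀ j, α j ≤ m) (p : ι × ι) :
    ∑ β ∈ lowerMulti α, |(∏ j, eCo p j ^ β j) * g (∑ j, β j)| ≤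
      ((m + 1 : ℝ) ^ 2 * M) *
        ((if α p.1 ≠ 0 then 1 else 0) + (if α p.2 ≠ 0 then 1 else 0)) := by
  set T := (lowerMulti α).filter (fun β => ∏ j, eCo p j ^ β j ≠ 0) with hT
  have hsum : ∑ β ∈ lowerMulti α, |(∏ j, eCo p j ^ β j) * g (∑ j, β j)| =
      ∑ β ∈ T, |(∏ j, eCo p j ^ β j) * g (∑ j, β j)| := by
    rw [hT]
    symm
    apply Finset.sum_filter_of_ne
    intro β _ h h0
    apply h
    simp [h0]
  have hmem : ∀ β ∈ T, β ≠ 0 ∧ β ≤ α ∧ ∀ j, j ≠ p.1 → j ≠ p.2 → β j = 0 := by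
    intro β hβ
    rw [hT, Finset.mem_filter, lowerMulti, Finset.mem_erase, Finset.mem_Iic] at hβ
    exact ⟨hβ.1.1, hβ.1.2, supp_of_ne p β hβ.2⟩
  have hterm : ∀ β ∈ T, |(∏ j, eCo p j ^ β j) * g (∑ j, β j)| ≤ M := by
    intro β hβ
    obtain ⟨_, hle, hs⟩ := hmem β hβ
    have hk : ∑ j, β j ≤ 2 * m := by
      have : ∑ j ∈ ({p.1, p.2} : Finset ι), β j = ∑ j, β j := by
        apply Finset.sum_subset (Finset.subset_univ _)
        intro j _ hj
        simp only [Finset.mem_insert, Finset.mem_singleton, not_or] at hj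
        exact hs j hj.1 hj.2
      rw [← this]
      calc _ ≤ ({p.1, p.2} : Finset ι).card • m :=
            Finset.sum_le_card_nsmul _ _ _ fun j _ => (hle j).trans (hα j)
        _ ≤ 2 * m := by
            rw [smul_eq_mul]
            exact Nat.mul_le_mul_right _ Finset.card_le_two
    rw [abs_mul]
    calc _ ≤ 1 * M := mul_le_mul (abs_prod_eCo_le p β) (hg _ hk) (abs_nonneg _) zero_le_one
      _ = M := one_mul M
  rw [hsum]
  have hnn : (0 : ℝ) ≤ (m + 1 : ℝ) ^ 2 * M := by positivity
  by_cases hp : α p.1 = 0 ∧ α p.2 = 0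
  · have hE : T = ∅ := by
      rw [Finset.eq_empty_iff_forall_notMem]
      intro β hβ
      obtain ⟨h0, hle, hs⟩ := hmem β hβ
      apply h0
      funext j
      by_cases h1 : j = p.1
      · have := hle j; rw [h1, hp.1] at this; rw [h1]; simpa using this
      by_cases h2 : j = p.2
      · have := hle j; rw [h2, hp.2] at this; rw [h2]; simpa using this
      exact hs j h1 h2
    simp [hE, hp.1, hp.2]
  · have hcard : T.card ≤ (m + 1) ^ 2 := by
      have := Finset.card_le_card_of_injOn (s := T)
        (t := Finset.range (m + 1) ×ˢ Finset.range (m + 1))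
        (fun β => (β p.1, β p.2))
        (by
          intro β hβ
          obtain ⟨_, hle, _⟩ := hmem β hβ
          have a1 : β p.1 ≤ m := (hle p.1).trans (hα p.1)
          have a2 : β p.2 ≤ m := (hle p.2).trans (hα p.2)
          simp only [Finset.coe_product, Finset.coe_range, Set.mem_prod, Set.mem_Iio]
          exact ⟨Nat.lt_succ_of_le a1, Nat.lt_succ_of_le a2⟩)
        (by
          intro β hβ γ hγ h
          obtain ⟨_, _, hs⟩ := hmem β hβ
          obtain ⟨_, _, hs'⟩ := hmem γ hγ
          simp only [Prod.mk.injEq] at h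
          funext j
          by_cases h1 : j = p.1
          · rw [h1]; exact h.1
          by_cases h2 : j = p.2
          · rw [h2]; exact h.2
          rw [hs j h1 h2, hs' j h1 h2])
      simpa [sq] using this
    have hone : (1 : ℝ) ≤ (if α p.1 ≠ 0 then 1 else 0) + (if α p.2 ≠ 0 then 1 else 0) := by
      by_cases h1 : α p.1 = 0
      · have h2 : α p.2 ≠ 0 := fun h2 => hp ⟨h1, h2⟩
        rw [if_neg (not_not.2 h1), if_pos h2]; norm_num
      · rw [if_pos h1]
        split_ifs <;> norm_num
    calc _ ≤ T.card • M := Finset.sum_le_card_nsmul _ _ _ hterm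
      _ ≤ (m + 1 : ℝ) ^ 2 * M := by
          rw [nsmul_eq_mul]
          have : (T.card : ℝ) ≤ (m + 1 : ℝ) ^ 2 := by exact_mod_cast hcard
          exact mul_le_mul_of_nonneg_right this hM
      _ ≤ _ := le_mul_of_one_le_right hnn hone

/-- (Mean field interaction.) For `G : ℝ → [0,∞)` smooth and bounded together
with all its derivatives, the potentials `V_Λ(x) = (1/|Λ|) ∑_{(j,k)∈Λ²} G(x_j - x_k)` on `ℝ^Λ`,
`Λ` a nonempty finite set, satisfy: for every `m ≥ 1` there is `C_m > 0`, independent of `Λ`,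
with `∑_{0≠β≤α} |∂^β V_Λ(x)| ≤ C_m |S(α)|` for all `Λ`, all `α ∈ ℕ^Λ` with `α_j ≤ m`, all `x`. -/
theorem mean_field_potential_estimate
    {Γ : Type*} [DecidableEq Γ] (G : ℝ → ℝ)
    (hGpos : ∀ y, 0 ≤ G y) (hG : ContDiff ℝ (⊤ : ℕ∞) G)
    (hGbdd : ∀ k : ℕ, ∃ M : ℝ, ∀ y, |iteratedDeriv k G y| ≤ M)
    (m : ℕ) (hm : 1 ≤ m) :
    ∃ C : ℝ, 0 < C ∧ ∀ (Λ : Finset Γ), Λ.Nonempty → ∀ (α : ↥Λ → ℕ), (∀ j, α j ≤ m) →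
      ∀ x : ↥Λ → ℝ,
        ∑ β ∈ lowerMulti α,
          |mderiv β
            (fun x : ↥Λ → ℝ =>
              ((Λ.card : ℝ))⁻¹ * ∑ p : ↥Λ × ↥Λ, G (x p.1 - x p.2)) x| ≤
          C * (suppCard α : ℝ) := by
  choose Mf hMf using hGbdd
  set M : ℝ := ∑ k ∈ Finset.range (2 * m + 1), |Mf k| + 1 with hMdef
  have hM : 0 < M := by positivity
  have hMk : ∀ k ≤ 2 * m, ∀ y, |iteratedDeriv k G y| ≤ M := by
    intro k hk y
    have h1 : |Mf k| ≤ ∑ k ∈ Finset.range (2 * m + 1), |Mf k| :=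
      Finset.single_le_sum (f := fun k => |Mf k|) (fun _ _ => abs_nonneg _)
        (Finset.mem_range.2 (by omega))
    have h2 := hMf k y
    have h3 := le_abs_self (Mf k)
    linarith
  set K : ℝ := (m + 1 : ℝ) ^ 2 * M with hK
  have hKpos : 0 < K := by positivity
  refine ⟨2 * K, by positivity, ?_⟩
  intro Λ hΛ α hα x
  have hn : (0 : ℝ) < (Λ.card : ℝ) := by exact_mod_cast hΛ.card_pos
  have hS : ∑ j : ↥Λ, (if α j ≠ 0 then (1 : ℝ) else 0) = (suppCard α : ℝ) := by
    rw [suppCard, Finset.sum_boole]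
  calc _ ≤ ∑ β ∈ lowerMulti α, (Λ.card : ℝ)⁻¹ * ∑ p : ↥Λ × ↥Λ,
          |(∏ j, eCo p j ^ β j) * iteratedDeriv (∑ j, β j) G (x p.1 - x p.2)| := by
        refine Finset.sum_le_sum fun β _ => ?_
        rw [mderiv_pair G hG, abs_mul, abs_of_pos (inv_pos.2 hn)]
        exact mul_le_mul_of_nonneg_left (Finset.abs_sum_le_sum_abs _ _) (inv_pos.2 hn).le
    _ = (Λ.card : ℝ)⁻¹ * ∑ p : ↥Λ × ↥Λ, ∑ β ∈ lowerMulti α,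
          |(∏ j, eCo p j ^ β j) * iteratedDeriv (∑ j, β j) G (x p.1 - x p.2)| := by
        rw [← Finset.mul_sum, Finset.sum_comm]
    _ ≤ (Λ.card : ℝ)⁻¹ * ∑ p : ↥Λ × ↥Λ, K *
          ((if α p.1 ≠ 0 then 1 else 0) + (if α p.2 ≠ 0 then 1 else 0)) := by
        refine mul_le_mul_of_nonneg_left (Finset.sum_le_sum fun p _ => ?_) (inv_pos.2 hn).le
        exact pair_bound (fun k => iteratedDeriv k G (x p.1 - x p.2)) M hM.le m
          (fun k hk => hMk k hk _) α hα p
    _ = (Λ.card : ℝ)⁻¹ * (K * (2 * (Λ.card * suppCard α))) := by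
        rw [← Finset.mul_sum, Finset.sum_add_distrib, Fintype.sum_prod_type,
          Fintype.sum_prod_type]
        have e1 : ∀ f : ↥Λ → ℝ, ∑ a : ↥Λ, ∑ _b : ↥Λ, f a = Λ.card * ∑ a, f a := by
          intro f
          simp only [Finset.sum_const, Finset.card_univ, Fintype.card_coe, nsmul_eq_mul,
            Finset.mul_sum]
        have e2 : ∀ f : ↥Λ → ℝ, ∑ _a : ↥Λ, ∑ b : ↥Λ, f b = Λ.card * ∑ a, f a := by
          intro f
          simp only [Finset.sum_const, Finset.card_univ, Fintype.card_coe, nsmul_eq_mul]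
        rw [e1 (fun a => if α a ≠ 0 then 1 else 0), e2 (fun a => if α a ≠ 0 then 1 else 0), hS]
        ring
    _ = 2 * K * suppCard α := by field_simp
end
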